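/- Integration of germs (coherence): let 𝖪 be a β-regularising kernel of order (m,r) with range ρ, and let α ≤ γ with m > γ + β. Then for every compact K ⊂ ℝ^d and λ̄ ∈ [1,∞) there is a constant cst'_{K,λ̄} < ∞ such that for every (α,γ)-coherent germ F of order r, the differences 𝖪F_y − 𝖪F_x = 𝖪(F_y − F_x) are well-defined and the germ 𝖪F is weakly (α+β, γ+β)-coherent of order r, with weak-coherence seminorm on (K,λ̄) at order r bounded by cst'_{K,λ̄} times the (α,γ)-coherence seminorm of F on (K, 2(λ̄+ρ)) at order r. -/

import Mathlib

open MeasureTheory Metric Filter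
open scoped Classical Pointwise Topology

noncomputable section

/-- Euclidean space `ℝ^d`. -/
abbrev Ed (d : ℕ) := EuclideanSpace ℝ (Fin d)

/-- Multi-indices `k ∈ ℕ₀^d`. -/
abbrev MIdx (d : ℕ) := Fin d → ℕ

variable {d : ℕ}

/-- Degree `|k|` of a multi-index. -/
def mdeg (k : MIdx d) : ℕ := ∑ i, k i

/-- Factorial `k!` of a multi-index. -/
def mfact (k : MIdx d) : ℕ := ∏ i, Nat.factorial (k i)

/-- Monomial `v^k`. -/
def mpow (v : Ed d) (k : MIdx d) : ℝ := ∏ i, (v i) ^ (k i)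

/-- Partial (line) derivative in coordinate `i`. -/
def pd (i : Fin d) (f : Ed d → ℝ) : Ed d → ℝ :=
  fun x => lineDeriv ℝ f x (EuclideanSpace.single i (1:ℝ))

/-- Iterated partial derivative `∂^k`. -/
def mderiv (k : MIdx d) (f : Ed d → ℝ) : Ed d → ℝ :=
  (List.finRange d).foldr (fun i g => (pd i)^[k i] g) f

/-- Smooth compactly supported test function. -/
def IsTest (φ : Ed d → ℝ) : Prop := ContDiff ℝ (⊤ : ℕ∞) φ ∧ HasCompactSupport φ

/-- The `C^r` norm `max_{|k| ≤ r} ‖∂^k φ‖_∞`. -/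
def crNorm (r : ℕ) (φ : Ed d → ℝ) : ℝ :=
  ⨆ k : {k : MIdx d // mdeg k ≤ r}, ⨆ x : Ed d, |mderiv k.1 φ x|

/-- Generalized functions: arbitrary functionals on functions on `ℝ^d`. -/
abbrev DFunc (d : ℕ) := (Ed d → ℝ) → ℝ

/-- `f` is a distribution in `𝒟'(ℝ^d)`: linear on test functions and,
on every compact, bounded by some `C^r` norm. -/
def IsDistribution (f : DFunc d) : Prop :=
  (∀ φ ψ : Ed d → ℝ, IsTest φ → IsTest ψ → f (φ + ψ) = f φ + f ψ) ∧
  (∀ (c : ℝ) (φ : Ed d → ℝ), IsTest φ → f (c • φ) = c * f φ) ∧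
  (∀ K : Set (Ed d), IsCompact K → ∃ (r : ℕ) (C : ℝ),
    ∀ φ : Ed d → ℝ, IsTest φ → tsupport φ ⊆ K → |f φ| ≤ C * crNorm r φ)

/-- `f` is a distribution of order `r` (bound by the `C^r` norm on every compact). -/
def DistOrder (f : DFunc d) (r : ℕ) : Prop :=
  ∀ K : Set (Ed d), IsCompact K → ∃ C : ℝ,
    ∀ φ : Ed d → ℝ, IsTest φ → tsupport φ ⊆ K → |f φ| ≤ C * crNorm r φ

/-- `φ` is of class `C^r`: all iterated coordinate-partials up to order `r`
exist and are continuous. -/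
def IsCr (r : ℕ) (φ : Ed d → ℝ) : Prop :=
  ∀ k : MIdx d, mdeg k ≤ r →
    Continuous (mderiv k φ) ∧
    (mdeg k < r → ∀ (i : Fin d) (x : Ed d),
      LineDifferentiableAt ℝ (mderiv k φ) x (EuclideanSpace.single i (1:ℝ)))

/-- The functional `f` acts canonically (linearly, with local order-`r` bounds) on all
compactly supported `C^r` functions; i.e. `f` incorporates the canonical extension of a
distribution of order `r`. -/
def OrderExt (f : DFunc d) (r : ℕ) : Prop :=
  (∀ φ ψ : Ed d → ℝ, IsCr r φ → HasCompactSupport φ → IsCr r ψ → HasCompactSupport ψ →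
      f (φ + ψ) = f φ + f ψ) ∧
  (∀ (c : ℝ) (φ : Ed d → ℝ), IsCr r φ → HasCompactSupport φ → f (c • φ) = c * f φ) ∧
  (∀ K : Set (Ed d), IsCompact K → ∃ C : ℝ,
    ∀ φ : Ed d → ℝ, IsCr r φ → HasCompactSupport φ → tsupport φ ⊆ K → |f φ| ≤ C * crNorm r φ)

/-- The scaled recentred test function `φ_x^λ(y) = λ^{-d} φ(λ^{-1}(y-x))`. -/
def scTF (φ : Ed d → ℝ) (x : Ed d) (l : ℝ) : Ed d → ℝ :=
  fun y => (l ^ d)⁻¹ * φ (l⁻¹ • (y - x))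

/-- The class `𝓑^r` of smooth test functions supported in the closed unit ball with
all derivatives of order `≤ r` bounded by one. -/
def TB (d r : ℕ) : Set (Ed d → ℝ) :=
  {φ | IsTest φ ∧ tsupport φ ⊆ closedBall (0 : Ed d) 1 ∧
    ∀ k : MIdx d, mdeg k ≤ r → ∀ x, |mderiv k φ x| ≤ 1}

/-- The class `𝓑_γ` of smooth test functions supported in the closed unit ball which
annihilate all monomials of degree `≤ γ`. -/
def TAnn (d : ℕ) (γ : ℝ) : Set (Ed d → ℝ) :=
  {φ | IsTest φ ∧ tsupport φ ⊆ closedBall (0 : Ed d) 1 ∧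
    ∀ k : MIdx d, (mdeg k : ℝ) ≤ γ → (∫ z, φ z * mpow z k) = 0}

/-- The class `𝓑^r_γ = 𝓑^r ∩ 𝓑_γ`. -/
def TBAnn (d r : ℕ) (γ : ℝ) : Set (Ed d → ℝ) := TB d r ∩ TAnn d γ

/-- A germ: a family of functionals indexed by base points. -/
abbrev GermF (d : ℕ) := Ed d → DFunc d

/-- A germ of distributions, measurable in the base point. -/
def IsGerm (F : GermF d) : Prop :=
  (∀ x, IsDistribution (F x)) ∧ ∀ φ : Ed d → ℝ, IsTest φ → Measurable (fun x => F x φ)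

/-- Homogeneity bound with constant `C`: `|F_x(φ_x^λ)| ≤ C λ^ᾱ` on `(K, λ̄)` at order `r`. -/
def HomB (F : GermF d) (a : ℝ) (r : ℕ) (K : Set (Ed d)) (lb C : ℝ) : Prop :=
  ∀ x ∈ K, ∀ l : ℝ, 0 < l → l ≤ lb → ∀ φ ∈ TB d r, |F x (scTF φ x l)| ≤ C * l ^ a

/-- Coherence bound with constant `C`:
`|(F_y - F_x)(φ_x^λ)| ≤ C λ^α (|y-x|+λ)^{γ-α}` on `(K, λ̄)` at order `r`. -/
def CohB (F : GermF d) (a g : ℝ) (r : ℕ) (K : Set (Ed d)) (lb C : ℝ) : Prop :=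
  ∀ x ∈ K, ∀ y ∈ K, ∀ l : ℝ, 0 < l → l ≤ lb → ∀ φ ∈ TB d r,
    |F y (scTF φ x l) - F x (scTF φ x l)| ≤ C * l ^ a * (dist y x + l) ^ (g - a)

/-- `F` is `ᾱ`-homogeneous of order `r`. -/
def Homog (F : GermF d) (a : ℝ) (r : ℕ) : Prop :=
  ∀ K : Set (Ed d), IsCompact K → ∀ lb : ℝ, 1 ≤ lb → ∃ C, HomB F a r K lb C

/-- `F` is `(α, γ)`-coherent of order `r`. -/
def Coh (F : GermF d) (a g : ℝ) (r : ℕ) : Prop :=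
  ∀ K : Set (Ed d), IsCompact K → ∀ lb : ℝ, 1 ≤ lb → ∃ C, CohB F a g r K lb C

/-- Weak homogeneity bound with constant `C` (test functions annihilating polynomials
at small scales, plus a scale-one bound on all of `𝓑^r`). -/
def WHomB (F : GermF d) (a : ℝ) (r : ℕ) (K : Set (Ed d)) (lb C : ℝ) : Prop :=
  (∀ x ∈ K, ∀ l : ℝ, 0 < l → l ≤ lb → ∀ φ ∈ TBAnn d r a,
      |F x (scTF φ x l)| ≤ C * l ^ a) ∧
  (∀ x ∈ K, ∀ ψ ∈ TB d r, |F x (scTF ψ x 1)| ≤ C)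

/-- Weak coherence bound with constant `C`. -/
def WCohB (F : GermF d) (a g : ℝ) (r : ℕ) (K : Set (Ed d)) (lb C : ℝ) : Prop :=
  (∀ x ∈ K, ∀ y ∈ K, ∀ l : ℝ, 0 < l → l ≤ lb → ∀ φ ∈ TBAnn d r g,
      |F y (scTF φ x l) - F x (scTF φ x l)| ≤ C * l ^ a * (dist y x + l) ^ (g - a)) ∧
  (∀ x ∈ K, ∀ y ∈ K, ∀ ψ ∈ TB d r, |F y (scTF ψ x 1) - F x (scTF ψ x 1)| ≤ C)

/-- `F` is weakly `ᾱ`-homogeneous of order `r`. -/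
def WHomog (F : GermF d) (a : ℝ) (r : ℕ) : Prop :=
  ∀ K : Set (Ed d), IsCompact K → ∀ lb : ℝ, 1 ≤ lb → ∃ C, WHomB F a r K lb C

/-- `F` is weakly `(α,γ)`-coherent of order `r`. -/
def WCoh (F : GermF d) (a g : ℝ) (r : ℕ) : Prop :=
  ∀ K : Set (Ed d), IsCompact K → ∀ lb : ℝ, 1 ≤ lb → ∃ C, WCohB F a g r K lb C

/-- The canonical order `r_{ᾱ,α} = min{n ∈ ℕ₀ : n > max(-ᾱ, -α)}`. -/
def rJ (a b : ℝ) : ℕ := (⌊max (-a) (-b)⌋ + 1).toNat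

/-- Joint homogeneity-and-coherence bound at the canonical order. -/
def JointB (F : GermF d) (ab a g : ℝ) (K : Set (Ed d)) (lb C : ℝ) : Prop :=
  HomB F ab (rJ ab a) K lb C ∧ CohB F a g (rJ ab a) K lb C

/-- Joint weak homogeneity-and-coherence bound at the canonical order. -/
def WJointB (F : GermF d) (ab a g : ℝ) (K : Set (Ed d)) (lb C : ℝ) : Prop :=
  WHomB F ab (rJ ab a) K lb C ∧ WCohB F a g (rJ ab a) K lb C

/-- `R` is a `γ`-reconstruction of the `(α,γ)`-coherent germ `F`. -/
def IsRec (F : GermF d) (R : DFunc d) (a g : ℝ) : Prop :=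
  ∀ r : ℕ, -a < (r : ℝ) → ∀ K : Set (Ed d), IsCompact K → ∃ C : ℝ,
    ∀ x ∈ K, ∀ l : ℝ, 0 < l → l ≤ 1 → ∀ φ ∈ TB d r,
      |F x (scTF φ x l) - R (scTF φ x l)| ≤ C * l ^ g

/-- Mixed partial derivative `∂_1^k ∂_2^l K(x,y)` of a kernel. -/
def mixDeriv (k l : MIdx d) (Kf : Ed d → Ed d → ℝ) (x y : Ed d) : ℝ :=
  mderiv k (fun x' => mderiv l (fun y' => Kf x' y') y) x

/-- The kernel `K(x,y)` is of class `C^{m,r}` (mixed partials `∂_1^k ∂_2^l`, `|k| ≤ m`,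
`|l| ≤ r`, exist and are continuous). -/
def IsCmr (m r : ℕ) (Kf : Ed d → Ed d → ℝ) : Prop :=
  ∀ k l : MIdx d, mdeg k ≤ m → mdeg l ≤ r →
    Continuous (fun p : Ed d × Ed d => mixDeriv k l Kf p.1 p.2) ∧
    (mdeg k < m → ∀ (i : Fin d) (x y : Ed d),
      LineDifferentiableAt ℝ (fun x' => mixDeriv k l Kf x' y) x
        (EuclideanSpace.single i (1:ℝ))) ∧
    (mdeg l < r → ∀ (j : Fin d) (x y : Ed d),
      LineDifferentiableAt ℝ (mderiv l (fun y' => Kf x y')) y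
        (EuclideanSpace.single j (1:ℝ)))

/-- `Kn` is the dyadic decomposition of a `β`-regularising kernel of order `(m,r)`
with range `ρ` (Definition 2.3 of the paper). -/
def RegKer (d : ℕ) (β : ℝ) (m r : ℕ) (ρ : ℝ) (Kn : ℕ → Ed d → Ed d → ℝ) : Prop :=
  (∀ n, IsCmr m r (Kn n)) ∧
  (∀ n x y, Kn n x y ≠ 0 → dist x y ≤ ρ * 2 ^ (-(n : ℝ))) ∧
  (∀ K : Set (Ed d), IsCompact K → ∃ c : ℝ, 0 < c ∧
    (∀ n, ∀ k l : MIdx d, mdeg k ≤ m → mdeg l ≤ r → ∀ x ∈ K, ∀ y ∈ K,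
      |mixDeriv k l (Kn n) x y| ≤
        c * 2 ^ ((((d : ℝ) - β + (mdeg l : ℝ) + (mdeg k : ℝ))) * n)) ∧
    (∀ n, ∀ k l : MIdx d, mdeg k ≤ r → mdeg l ≤ r → ∀ y ∈ K,
      |∫ x, mpow (y - x) l * mderiv k (fun y' => Kn n x y') y| ≤ c * 2 ^ (-(β * (n : ℝ)))))

/-- `K_n^* ψ (y) = ∫ ψ(x) K_n(x,y) dx`. -/
def kstar (Kf : Ed d → Ed d → ℝ) (ψ : Ed d → ℝ) : Ed d → ℝ :=
  fun y => ∫ x, ψ x * Kf x y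

/-- `g = 𝖪 f`, i.e. `g(ψ) = Σ_n f(K_n^* ψ)` (with convergence) on test functions. -/
def KInt (Kn : ℕ → Ed d → Ed d → ℝ) (f g : DFunc d) : Prop :=
  ∀ ψ : Ed d → ℝ, IsTest ψ → HasSum (fun n => f (kstar (Kn n) ψ)) (g ψ)

/-- The kernel decomposition preserves polynomials at level `γ`. -/
def PresPoly (Kn : ℕ → Ed d → Ed d → ℝ) (γ : ℝ) : Prop :=
  ∀ n, ∀ k : MIdx d, (mdeg k : ℝ) ≤ γ →
    ∃ p : MvPolynomial (Fin d) ℝ, p.totalDegree ≤ mdeg k ∧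
      ∀ x : Ed d, (∫ y, Kn n x y * mpow y k) = MvPolynomial.eval (fun i => x i) p

/-- Distributional derivative `D^k f (φ) = (-1)^{|k|} f(∂^k φ)`. -/
def distDeriv (k : MIdx d) (f : DFunc d) : DFunc d :=
  fun φ => (-1 : ℝ) ^ (mdeg k) * f (mderiv k φ)

/-- `η ∈ 𝒟` with `∫ η = 1` and vanishing moments of orders `1 ≤ |l| < δ`. -/
def GoodEta (δ : ℝ) (η : Ed d → ℝ) : Prop :=
  IsTest η ∧ (∫ z, η z) = 1 ∧
    ∀ k : MIdx d, 1 ≤ mdeg k → (mdeg k : ℝ) < δ → (∫ z, η z * mpow z k) = 0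

/-- `v` is the pointwise derivative `D^k f(x)`, defined through the limit
`lim_{λ↓0} D^k f(η_x^λ)` for every admissible mollifier `η`. -/
def HasPtDeriv (f : DFunc d) (δ : ℝ) (k : MIdx d) (x : Ed d) (v : ℝ) : Prop :=
  ∀ η : Ed d → ℝ, GoodEta δ η →
    Tendsto (fun l : ℝ => distDeriv k f (scTF η x l)) (nhdsWithin 0 (Set.Ioi 0)) (nhds v)

/-- The Taylor polynomial `Σ_{|k| < δ} c_k (·-x)^k / k!`, viewed as the functional
`ψ ↦ Σ_{|k| < δ} c_k ∫ ψ(y) (y-x)^k / k! dy`. -/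
def taylorF (δ : ℝ) (c : MIdx d → ℝ) (x : Ed d) : DFunc d :=
  fun ψ => ∑ᶠ k ∈ {k : MIdx d | (mdeg k : ℝ) < δ},
    c k * ((∫ y, ψ y * mpow (y - x) k) / (mfact k))

/-- The smallest positive integer `> -γ` (used in Hölder–Zygmund spaces for `γ < 0`). -/
def rNeg (γ : ℝ) : ℕ := (⌊-γ + 1⌋).toNat

/-- The Hölder–Zygmund bound with constant `C` on the compact `K` (with `λ̄ = 1`). -/
def ZBound (γ : ℝ) (f : DFunc d) (K : Set (Ed d)) (C : ℝ) : Prop :=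
  (γ < 0 → ∀ x ∈ K, ∀ l : ℝ, 0 < l → l ≤ 1 → ∀ φ ∈ TB d (rNeg γ),
    |f (scTF φ x l)| ≤ C * l ^ γ) ∧
  (0 ≤ γ →
    (∀ x ∈ K, ∀ ψ ∈ TB d 0, |f (scTF ψ x 1)| ≤ C) ∧
    (∀ x ∈ K, ∀ l : ℝ, 0 < l → l ≤ 1 → ∀ φ ∈ TBAnn d 0 γ,
      |f (scTF φ x l)| ≤ C * l ^ γ))

/-- Membership in the local Hölder–Zygmund space `𝒵^γ`. -/
def MemZ (γ : ℝ) (f : DFunc d) : Prop :=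
  IsDistribution f ∧ ∀ K : Set (Ed d), IsCompact K → ∃ C, ZBound γ f K C

/-- `(Pg, Gg)` is a model with homogeneities `α` of order `rP`, with index set `S`. -/
def IsModelOn {ι : Type} (S : Finset ι) (Pg : ι → GermF d)
    (Gg : ι → ι → Ed d → Ed d → ℝ) (α : ι → ℝ) (rP : ℕ) : Prop :=
  (∀ i ∈ S, IsGerm (Pg i)) ∧
  (∀ i ∈ S, Homog (Pg i) (α i) rP) ∧
  (∀ i ∈ S, ∀ x y : Ed d, ∀ φ : Ed d → ℝ, IsTest φ →
    Pg i y φ = ∑ j ∈ S, Pg j x φ * Gg j i x y)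

/-- The modelled-distribution bound with constant `C` on the compact `K`. -/
def MDB {ι : Type} (S : Finset ι) (Gg : ι → ι → Ed d → Ed d → ℝ) (α : ι → ℝ)
    (γ : ℝ) (f : Ed d → ι → ℝ) (K : Set (Ed d)) (C : ℝ) : Prop :=
  (∀ x ∈ K, ∀ i ∈ S, |f x i| ≤ C) ∧
  (∀ x ∈ K, ∀ y ∈ K, ∀ i ∈ S,
    |(∑ j ∈ S, Gg i j x y * f y j) - f x i| ≤ C * (dist y x) ^ (γ - α i))

/-- `f` is a modelled distribution of order `γ` relative to the model data. -/
def IsMD {ι : Type} (S : Finset ι) (Gg : ι → ι → Ed d → Ed d → ℝ) (α : ι → ℝ)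
    (γ : ℝ) (f : Ed d → ι → ℝ) : Prop :=
  (∀ i ∈ S, Measurable fun x : Ed d => f x i) ∧
  ∀ K : Set (Ed d), IsCompact K → ∃ C, MDB S Gg α γ f K C

/-- The germ `⟨f, Π⟩_x = Σ_i f^i(x) Π^i_x`. -/
def germOf {ι : Type} (S : Finset ι) (Pg : ι → GermF d) (f : Ed d → ι → ℝ) : GermF d :=
  fun x φ => ∑ i ∈ S, f x i * Pg i x φ

/-- Weak coherence bound for a family of differences `(x,y) ↦ 𝖪F_y - 𝖪F_x`. -/
def WCohBD {d : ℕ} (Fd : Ed d → Ed d → DFunc d) (a g : ℝ) (r : ℕ)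
    (K : Set (Ed d)) (lb C : ℝ) : Prop :=
  (∀ x ∈ K, ∀ y ∈ K, ∀ l : ℝ, 0 < l → l ≤ lb → ∀ φ ∈ TBAnn d r g,
      |Fd x y (scTF φ x l)| ≤ C * l ^ a * (dist y x + l) ^ (g - a)) ∧
  (∀ x ∈ K, ∀ y ∈ K, ∀ ψ ∈ TB d r, |Fd x y (scTF ψ x 1)| ≤ C)



abbrev ee (i : Fin d) : Ed d := EuclideanSpace.single i (1:ℝ)

abbrev sg (i : Fin d) : MIdx d := Pi.single i 1

lemma mdeg_add (k l : MIdx d) : mdeg (k + l) = mdeg k + mdeg l := by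
  simp [mdeg, Finset.sum_add_distrib]

lemma mdeg_sg (i : Fin d) : mdeg (sg i) = 1 := by
  simp [mdeg, sg]

lemma mdeg_zero : mdeg (0 : MIdx d) = 0 := by simp [mdeg]

lemma mdeg_add_sg (k : MIdx d) (i : Fin d) : mdeg (k + sg i) = mdeg k + 1 := by
  rw [mdeg_add, mdeg_sg]

lemma mderiv_zero (f : Ed d → ℝ) : mderiv 0 f = f := by
  unfold mderiv
  induction List.finRange d with
  | nil => rfl
  | cons a l ih => simp

lemma foldr_congr_k (L : List (Fin d)) (k k' : MIdx d) (h : ∀ i ∈ L, k i = k' i) (f : Ed d → ℝ) :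
    L.foldr (fun i g => (pd i)^[k i] g) f = L.foldr (fun i g => (pd i)^[k' i] g) f := by
  induction L with
  | nil => rfl
  | cons a l ih =>
    simp only [List.foldr_cons]
    rw [ih (fun i hi => h i (List.mem_cons_of_mem _ hi)), h a List.mem_cons_self]

lemma foldr_zero_k (L : List (Fin d)) (k : MIdx d) (h : ∀ i ∈ L, k i = 0) (f : Ed d → ℝ) :
    L.foldr (fun i g => (pd i)^[k i] g) f = f := by
  induction L with
  | nil => rfl
  | cons a l ih =>
    simp only [List.foldr_cons]
    rw [ih (fun i hi => h i (List.mem_cons_of_mem _ hi)), h a List.mem_cons_self]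
    rfl

lemma pd_mderiv (k : MIdx d) (i : Fin d) (h : ∀ j < i, k j = 0) (f : Ed d → ℝ) :
    mderiv (k + sg i) f = pd i (mderiv k f) := by
  obtain ⟨s, t, hst⟩ := List.append_of_mem (List.mem_finRange i)
  have hp := List.pairwise_lt_finRange d
  rw [hst, List.pairwise_append] at hp
  obtain ⟨_, h2, h3⟩ := hp
  have hs : ∀ j ∈ s, j < i := fun j hj => h3 j hj i List.mem_cons_self
  have ht : ∀ j ∈ t, i < j := fun j hj => (List.pairwise_cons.1 h2).1 j hj
  unfold mderiv
  rw [hst, List.foldr_append, List.foldr_append, List.foldr_cons, List.foldr_cons]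
  rw [foldr_zero_k s k (fun j hj => h j (hs j hj))]
  rw [foldr_zero_k s (k + sg i) (fun j hj => by
    simp [sg, h j (hs j hj), (hs j hj).ne])]
  rw [foldr_congr_k t (k + sg i) k (fun j hj => by simp [sg, (ht j hj).ne'])]
  have : (k + sg i) i = k i + 1 := by simp [sg]
  rw [this, Function.iterate_succ_apply']

lemma midx_decomp (k : MIdx d) (hk : k ≠ 0) :
    ∃ (i : Fin d) (k' : MIdx d), k = k' + sg i ∧ (∀ j < i, k' j = 0) := by
  have hne : (Finset.univ.filter (fun i => k i ≠ 0)).Nonempty := by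
    by_contra hcon
    apply hk
    funext i
    by_contra hi
    exact hcon ⟨i, by simpa using hi⟩
  set i := (Finset.univ.filter (fun i => k i ≠ 0)).min' hne with hi
  have hik : k i ≠ 0 := by
    have := Finset.min'_mem _ hne
    rw [← hi] at this
    simpa using this
  have hlt : ∀ j < i, k j = 0 := by
    intro j hj
    by_contra hjk
    have := Finset.min'_le (Finset.univ.filter (fun i => k i ≠ 0)) j (by simpa using hjk)
    rw [← hi] at this
    exact absurd hj (not_lt.2 this)
  refine ⟨i, fun j => k j - sg i j, ?_, ?_⟩
  · funext j
    by_cases hj : j = i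
    · subst hj
      simp [sg]
      omega
    · simp [sg, hj]
  · intro j hj
    simp [hlt j hj]

lemma midx_induction {P : MIdx d → Prop} (h0 : P 0)
    (hs : ∀ k i, (∀ j < i, k j = 0) → P k → P (k + sg i)) : ∀ k, P k := by
  intro k
  induction hn : mdeg k using Nat.strong_induction_on generalizing k with
  | _ n ih =>
    by_cases hk : k = 0
    · subst hk; exact h0
    · obtain ⟨i, k', rfl, h⟩ := midx_decomp k hk
      rw [mdeg_add_sg] at hn
      exact hs k' i h (ih _ (by omega) k' rfl)

/-- line derivative at shifted parameter -/
lemma hasDerivAt_line {f : Ed d → ℝ} {D : Ed d → ℝ} {v : Ed d}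
    (h : ∀ x, HasLineDerivAt ℝ f (D x) x v) (x : Ed d) (t : ℝ) :
    HasDerivAt (fun s : ℝ => f (x + s • v)) (D (x + t • v)) t := by
  have h1 : HasDerivAt (fun s : ℝ => f ((x + t • v) + s • v)) (D (x + t • v)) (t - t) := by
    rw [sub_self]; exact h (x + t • v)
  have h2 := HasDerivAt.comp_sub_const t t h1
  have e : (fun s : ℝ => f (x + s • v)) = fun s : ℝ => f (x + t • v + (s - t) • v) := by
    funext s
    congr 1
    rw [add_assoc, ← add_smul]
    simp
  rw [e]
  exact h2

lemma hasDerivAt_setIntegral {Y : Type*} [TopologicalSpace Y] [MeasurableSpace Y]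
    [OpensMeasurableSpace Y] (μ : Measure Y) [IsLocallyFiniteMeasure μ]
    {s : Set Y} (hs : IsCompact s) (hsm : MeasurableSet s) {f f' : ℝ → Y → ℝ}
    (hf : Continuous (Function.uncurry f)) (hf' : Continuous (Function.uncurry f'))
    (h : ∀ t a, HasDerivAt (fun t => f t a) (f' t a) t) (t : ℝ) :
    HasDerivAt (fun t => ∫ a in s, f t a ∂μ) (∫ a in s, f' t a ∂μ) t := by
  have hc : IsCompact (closedBall t 1 ×ˢ s) := (isCompact_closedBall t 1).prod hs
  obtain ⟨M, hM⟩ := hc.bddAbove_image hf'.norm.continuousOn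
  have hfin : IsFiniteMeasure (μ.restrict s) := ⟨by simpa using hs.measure_lt_top⟩
  refine (hasDerivAt_integral_of_dominated_loc_of_deriv_le (μ := μ.restrict s)
    (closedBall_mem_nhds t one_pos) (bound := fun _ => M) ?_ ?_ ?_ ?_ ?_ ?_).2
  · exact Eventually.of_forall fun x => Continuous.aestronglyMeasurable (by fun_prop)
  · exact (Continuous.continuousOn (by fun_prop)).integrableOn_compact' hs hsm
  · exact Continuous.aestronglyMeasurable (by fun_prop)
  · refine (ae_restrict_iff' hsm).2 (Eventually.of_forall fun a ha x hx => ?_)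
    exact hM (Set.mem_image_of_mem _ (Set.mk_mem_prod hx ha))
  · exact integrable_const M
  · exact Eventually.of_forall fun a x _ => h x a

/-- strong Clairaut -/
lemma clairaut {u ui uj h : Ed d → ℝ} {v w : Ed d}
    (hui : ∀ x, HasLineDerivAt ℝ u (ui x) x v)
    (huj : ∀ x, HasLineDerivAt ℝ u (uj x) x w)
    (hh : ∀ x, HasLineDerivAt ℝ uj (h x) x v)
    (cuj : Continuous uj) (ch : Continuous h) (x : Ed d) :
    HasLineDerivAt ℝ ui (h x) x w := by
  have key : ∀ x : Ed d, ∀ t : ℝ, u (x + t • w) - u x =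
      t * ∫ s in Set.Icc (0:ℝ) 1, uj (x + (s * t) • w) := by
    intro x t
    have h1 : ∀ s : ℝ, HasDerivAt (fun s : ℝ => u (x + (s * t) • w)) (uj (x + (s * t) • w) * t) s := by
      intro s
      have := hasDerivAt_line huj x (s * t)
      exact HasDerivAt.comp (h₂ := fun s : ℝ => u (x + s • w)) s this (hasDerivAt_mul_const t)
    have h2 := intervalIntegral.integral_eq_sub_of_hasDerivAt (a := 0) (b := 1)
      (fun s _ => h1 s) (Continuous.intervalIntegrable (by fun_prop) _ _)
    rw [intervalIntegral.integral_of_le zero_le_one, ← integral_Icc_eq_integral_Ioc] at h2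
    simp only [one_mul, zero_mul, zero_smul, add_zero] at h2
    rw [← h2, integral_mul_const, mul_comm]
  have key2 : ∀ t : ℝ, ui (x + t • w) - ui x =
      t * ∫ s in Set.Icc (0:ℝ) 1, h (x + (s * t) • w) := by
    intro t
    have e1 : HasDerivAt (fun q : ℝ => u ((x + q • v) + t • w) - u (x + q • v))
        (ui (x + t • w) - ui x) 0 := by
      have a1 := hui (x + t • w)
      have a2 := hui x
      unfold HasLineDerivAt at a1 a2
      refine HasDerivAt.fun_sub ?_ a2
      convert a1 using 2 with q
      congr 1; abel
    have e2 := (hasDerivAt_setIntegral (μ := (volume : Measure ℝ)) (isCompact_Icc (a := (0:ℝ)) (b := 1))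
      measurableSet_Icc (f := fun q s => uj ((x + (s * t) • w) + q • v))
      (f' := fun q s => h ((x + (s * t) • w) + q • v))
      (by unfold Function.uncurry; fun_prop) (by unfold Function.uncurry; fun_prop)
      (fun q s => hasDerivAt_line hh _ q) 0).const_mul t
    simp only [zero_smul, add_zero] at e2
    refine e1.unique (e2.congr_of_eventuallyEq (Eventually.of_forall fun q => ?_))
    simp only [key]
    congr 2
    funext s
    congr 1; abel
  rw [hasLineDerivAt_iff_tendsto_slope_zero]
  have cI : Continuous (fun t : ℝ => ∫ s in Set.Icc (0:ℝ) 1, h (x + (s * t) • w)) :=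
    continuous_parametric_integral_of_continuous (by unfold Function.uncurry; fun_prop) isCompact_Icc
  have l1 : Tendsto (fun t : ℝ => ∫ s in Set.Icc (0:ℝ) 1, h (x + (s * t) • w)) (𝓝[≠] 0) (𝓝 (h x)) := by
    have := (cI.tendsto 0).mono_left (nhdsWithin_le_nhds (s := {0}ᶜ))
    simpa using this
  refine l1.congr' ?_
  filter_upwards [self_mem_nhdsWithin] with t ht
  have ht' : t ≠ 0 := ht
  rw [key2, smul_eq_mul, inv_mul_cancel_left₀ ht']

lemma IsCr.hasLineDerivAt {r : ℕ} {f : Ed d → ℝ} (hf : IsCr r f) (k : MIdx d) (hk : mdeg k < r)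
    (j : Fin d) (x : Ed d) : HasLineDerivAt ℝ (mderiv k f) (mderiv (k + sg j) f x) x (ee j) := by
  induction hn : mdeg k using Nat.strong_induction_on generalizing k j x with
  | _ n ih =>
    have direct : ∀ (k : MIdx d) (j : Fin d) (x : Ed d), mdeg k < r → (∀ i < j, k i = 0) →
        HasLineDerivAt ℝ (mderiv k f) (mderiv (k + sg j) f x) x (ee j) := by
      intro k j x hk h
      rw [pd_mderiv k j h]
      exact ((hf k hk.le).2 hk j x).hasLineDerivAt
    by_cases h : ∀ i < j, k i = 0
    · exact direct k j x hk h
    · push Not at h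
      obtain ⟨i0, hi0, hki0⟩ := h
      obtain ⟨i, k', rfl, h'⟩ := midx_decomp k (fun h => hki0 (by simp [h]))
      rw [mdeg_add_sg] at hn hk
      have hij : i < j := by
        by_contra hcon
        apply hki0
        have : i0 < i := lt_of_lt_of_le hi0 (not_lt.1 hcon)
        simp [h' i0 this, sg, this.ne]
      have e : k' + sg i + sg j = k' + sg j + sg i := by abel
      rw [e]
      refine clairaut (u := mderiv k' f) (uj := mderiv (k' + sg j) f)
        (ih (mdeg k') (by omega) k' (by omega) i · rfl)
        (ih (mdeg k') (by omega) k' (by omega) j · rfl)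
        (fun x => direct (k' + sg j) i x (by rw [mdeg_add_sg]; omega) ?_) ?_ ?_ x
      · intro a ha
        simp [h' a ha, sg, (ha.trans hij).ne]
      · exact (hf _ (by rw [mdeg_add_sg]; omega)).1
      · exact (hf _ (by rw [mdeg_add_sg, mdeg_add_sg]; omega)).1

lemma hasLineDerivAt_add {g Du Dw : Ed d → ℝ} {u w : Ed d}
    (hu : ∀ x, HasLineDerivAt ℝ g (Du x) x u) (hw : ∀ x, HasLineDerivAt ℝ g (Dw x) x w)
    (cu : Continuous Du) (cw : Continuous Dw) (x : Ed d) :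
    HasLineDerivAt ℝ g (Du x + Dw x) x (u + w) := by
  have := hasStrictFDerivAt_uncurry_coprod (𝕜 := ℝ) (u := ((0:ℝ), (0:ℝ)))
    (f := fun s t => g (x + s • u + t • w))
    (f₁ := fun s t => ContinuousLinearMap.toSpanSingleton ℝ (Du (x + s • u + t • w)))
    (f₂ := fun s t => ContinuousLinearMap.toSpanSingleton ℝ (Dw (x + s • u + t • w)))
    (Eventually.of_forall fun p => by
      have := (hasDerivAt_line hu (x + p.2 • w) p.1).hasFDerivAt
      have e : ∀ s : ℝ, x + p.2 • w + s • u = x + s • u + p.2 • w := fun s => by abel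
      simp only [e] at this
      exact this)
    (Eventually.of_forall fun p => by
      exact (hasDerivAt_line hw (x + p.1 • u) p.2).hasFDerivAt)
    (by
      have : Continuous (fun p : ℝ × ℝ => ContinuousLinearMap.toSpanSingleton ℝ (Du (x + p.1 • u + p.2 • w))) := by
        have hc : Continuous (fun p : ℝ × ℝ => Du (x + p.1 • u + p.2 • w)) := by fun_prop
        exact (ContinuousLinearMap.toSpanSingletonLE ℝ ℝ ℝ).continuous_of_finiteDimensional.comp hc
      exact this.continuousAt)
    (by
      have : Continuous (fun p : ℝ × ℝ => ContinuousLinearMap.toSpanSingleton ℝ (Dw (x + p.1 • u + p.2 • w))) := by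
        have hc : Continuous (fun p : ℝ × ℝ => Dw (x + p.1 • u + p.2 • w)) := by fun_prop
        exact (ContinuousLinearMap.toSpanSingletonLE ℝ ℝ ℝ).continuous_of_finiteDimensional.comp hc
      exact this.continuousAt)
  have hd : HasDerivAt (fun t : ℝ => (t, t)) ((1:ℝ), (1:ℝ)) 0 :=
    (hasDerivAt_id (0:ℝ)).prodMk (hasDerivAt_id (0:ℝ))
  have h2 := HasFDerivAt.comp_hasDerivAt (f := fun t : ℝ => (t, t)) (0:ℝ) this.hasFDerivAt hd
  unfold HasLineDerivAt
  convert h2 using 1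
  · funext t
    simp [Function.HasUncurry.uncurry, add_assoc]
  · simp [Function.HasUncurry.uncurry]

lemma hasLineDerivAt_sum {g : Ed d → ℝ} {D : Fin d → Ed d → ℝ}
    (h : ∀ i x, HasLineDerivAt ℝ g (D i x) x (ee i)) (hc : ∀ i, Continuous (D i)) (v : Ed d)
    (x : Ed d) : HasLineDerivAt ℝ g (∑ i, v i * D i x) x v := by
  have key : ∀ S : Finset (Fin d), ∀ x, HasLineDerivAt ℝ g (∑ i ∈ S, v i * D i x) x
      (∑ i ∈ S, v i • ee i) := by
    intro S
    induction S using Finset.induction_on with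
    | empty => intro x; simpa using hasLineDerivAt_zero
    | insert i S hi ih =>
      intro x
      rw [Finset.sum_insert hi, Finset.sum_insert hi]
      exact hasLineDerivAt_add (Du := fun x => v i * D i x) (Dw := fun x => ∑ i ∈ S, v i * D i x)
        (fun x => (h i x).smul (v i)) ih (by have := hc i; fun_prop)
        (continuous_finset_sum _ fun i _ => by have := hc i; fun_prop) x
  have := key Finset.univ x
  convert this using 1
  ext j
  simp [ee, Finset.sum_apply, Pi.single_apply]

lemma isCr_of {r : ℕ} {f : Ed d → ℝ} (D : MIdx d → Ed d → ℝ) (h0 : D 0 = f)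
    (hc : ∀ k, mdeg k ≤ r → Continuous (D k))
    (hd : ∀ k, mdeg k < r → ∀ i x, HasLineDerivAt ℝ (D k) (D (k + sg i) x) x (ee i)) :
    IsCr r f ∧ ∀ k, mdeg k ≤ r → mderiv k f = D k := by
  have key : ∀ k, mdeg k ≤ r → mderiv k f = D k := by
    intro k
    induction k using midx_induction with
    | h0 => intro _; rw [mderiv_zero, h0]
    | hs k i hki ih =>
      intro hk
      rw [mdeg_add_sg] at hk
      rw [pd_mderiv k i hki, ih (by omega)]
      funext x
      exact (hd k (by omega) i x).lineDeriv
  refine ⟨fun k hk => ?_, key⟩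
  rw [key k hk]
  exact ⟨hc k hk, fun hk' i x => (hd k hk' i x).lineDifferentiableAt⟩

lemma contDiff_pd {f : Ed d → ℝ} (hf : ContDiff ℝ (⊤ : ℕ∞) f) (i : Fin d) :
    ContDiff ℝ (⊤ : ℕ∞) (pd i f) := by
  have : pd i f = fun x => fderiv ℝ f x (ee i) := by
    funext x
    exact ((hf.differentiable (by simp)) x).lineDeriv_eq_fderiv
  rw [this]
  exact (hf.fderiv_right (m := (⊤ : ℕ∞)) (by simp)).clm_apply contDiff_const

lemma contDiff_mderiv {f : Ed d → ℝ} (hf : ContDiff ℝ (⊤ : ℕ∞) f) (k : MIdx d) :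
    ContDiff ℝ (⊤ : ℕ∞) (mderiv k f) := by
  induction k using midx_induction with
  | h0 => rwa [mderiv_zero]
  | hs k i hki ih => rw [pd_mderiv k i hki]; exact contDiff_pd ih i

lemma isCr_of_contDiff {f : Ed d → ℝ} (hf : ContDiff ℝ (⊤ : ℕ∞) f) (r : ℕ) : IsCr r f := by
  intro k _
  refine ⟨(contDiff_mderiv hf k).continuous, fun _ i x => ?_⟩
  exact (((contDiff_mderiv hf k).differentiable (by simp)) x).lineDifferentiableAt

lemma IsCr.mono {r r' : ℕ} {f : Ed d → ℝ} (hf : IsCr r f) (h : r' ≤ r) : IsCr r' f :=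
  fun k hk => ⟨(hf k (hk.trans h)).1, fun hk' => (hf k (hk.trans h)).2 (lt_of_lt_of_le hk' h)⟩

lemma IsCr.continuous {r : ℕ} {f : Ed d → ℝ} (hf : IsCr r f) : Continuous f := by
  have := (hf 0 (by simp [mdeg_zero])).1
  rwa [mderiv_zero] at this

lemma IsCr.sub {r : ℕ} {f g : Ed d → ℝ} (hf : IsCr r f) (hg : IsCr r g) :
    IsCr r (f - g) ∧ ∀ k, mdeg k ≤ r → mderiv k (f - g) = mderiv k f - mderiv k g := by
  refine isCr_of (fun k => mderiv k f - mderiv k g) (by simp [mderiv_zero])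
    (fun k hk => (hf k hk).1.sub (hg k hk).1) (fun k hk i x => ?_)
  exact HasDerivAt.sub (hf.hasLineDerivAt k hk i x) (hg.hasLineDerivAt k hk i x)

lemma IsCr.smul {r : ℕ} {f : Ed d → ℝ} (hf : IsCr r f) (c : ℝ) :
    IsCr r (c • f) ∧ ∀ k, mdeg k ≤ r → mderiv k (c • f) = c • mderiv k f := by
  refine isCr_of (fun k => c • mderiv k f) (by simp [mderiv_zero])
    (fun k hk => (hf k hk).1.const_smul c) (fun k hk i x => ?_)
  have := HasDerivAt.const_mul c (hf.hasLineDerivAt k hk i x)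
  exact this

lemma pd_scale (i : Fin d) (f : Ed d → ℝ) (c l : ℝ) (a : Ed d) :
    pd i (fun z => c * f (a + l • z)) = fun z => (c * l) * pd i f (a + l • z) := by
  funext z
  simp only [pd, lineDeriv]
  rw [deriv_const_mul_field]
  have : (fun t : ℝ => f (a + l • (z + t • ee i))) =
      fun t : ℝ => (fun s : ℝ => f (a + l • z + s • ee i)) (l * t) := by
    funext t
    simp only [smul_add, smul_smul, add_assoc]
  have e := deriv_comp_mul_left l (fun s : ℝ => f (a + l • z + s • ee i)) 0
  rw [this, e]
  simp [mul_assoc]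

lemma mderiv_scale (k : MIdx d) (f : Ed d → ℝ) (c l : ℝ) (a : Ed d) :
    mderiv k (fun z => c * f (a + l • z)) = fun z => (c * l ^ mdeg k) * mderiv k f (a + l • z) := by
  induction k using midx_induction with
  | h0 => simp [mderiv_zero, mdeg_zero]
  | hs k i hki ih =>
    rw [pd_mderiv k i hki, pd_mderiv k i hki, ih, pd_scale, mdeg_add_sg]
    funext z
    ring

lemma mderiv_scTF (k : MIdx d) (φ : Ed d → ℝ) (x : Ed d) (l : ℝ) (y : Ed d) :
    mderiv k (scTF φ x l) y = (l ^ d)⁻¹ * (l⁻¹) ^ mdeg k * mderiv k φ (l⁻¹ • (y - x)) := by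
  have e : scTF φ x l = fun z => (l ^ d)⁻¹ * φ (- (l⁻¹ • x) + l⁻¹ • z) := by
    funext z
    simp only [scTF]
    congr 2
    rw [smul_sub]; abel
  rw [e, mderiv_scale]
  simp only
  congr 2
  rw [smul_sub]; abel

lemma mderiv_shift (k : MIdx d) (f : Ed d → ℝ) (x : Ed d) :
    mderiv k (fun y => f (y - x)) = fun y => mderiv k f (y - x) := by
  have := mderiv_scale k f 1 1 (-x)
  simp only [one_mul, one_smul, one_pow, neg_add_eq_sub] at this
  exact this

lemma mderiv_zero_on {U : Set (Ed d)} (hU : IsOpen U) {f : Ed d → ℝ} (hf : ∀ x ∈ U, f x = 0)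
    (k : MIdx d) : ∀ x ∈ U, mderiv k f x = 0 := by
  induction k using midx_induction with
  | h0 => rwa [mderiv_zero]
  | hs k i hki ih =>
    intro x hx
    rw [pd_mderiv k i hki]
    have : mderiv k f =ᶠ[𝓝 x] fun _ => 0 := by
      filter_upwards [hU.mem_nhds hx] with y hy using ih y hy
    simp only [pd]
    rw [this.lineDeriv_eq]
    simp [lineDeriv]

lemma isTest_scTF {φ : Ed d → ℝ} (hφ : IsTest φ) (x : Ed d) {l : ℝ} (hl : 0 < l) :
    IsTest (scTF φ x l) := by
  constructor
  · have := hφ.1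
    unfold scTF
    fun_prop
  · have h1 : HasCompactSupport (fun y : Ed d => φ (l⁻¹ • (y - x))) := by
      have := hφ.2.comp_homeomorph
        ((Homeomorph.addRight (-x)).trans (Homeomorph.smulOfNeZero l⁻¹ (inv_ne_zero hl.ne')))
      simpa [Function.comp_def, sub_eq_add_neg] using this
    exact h1.mul_left

/-- Taylor -/
def cnt {j : ℕ} (s : Fin j → Fin d) : MIdx d := ∑ a, sg (s a)

lemma mdeg_cnt {j : ℕ} (s : Fin j → Fin d) : mdeg (cnt s) = j := by
  induction j with
  | zero => simp [cnt, mdeg]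
  | succ n ih =>
    have : cnt s = sg (s 0) + cnt (fun a => s (Fin.succ a)) := by
      simp [cnt, Fin.sum_univ_succ]
    rw [this, mdeg_add, mdeg_sg, ih]; omega

lemma mpow_add (v : Ed d) (k l : MIdx d) : mpow v (k + l) = mpow v k * mpow v l := by
  simp [mpow, pow_add, Finset.prod_mul_distrib]

lemma mpow_sg (v : Ed d) (i : Fin d) : mpow v (sg i) = v i := by
  unfold mpow
  rw [Finset.prod_eq_single i]
  · simp [sg]
  · intro b _ hb; simp [sg, hb]
  · simp

lemma mpow_smul (c : ℝ) (v : Ed d) (k : MIdx d) : mpow (c • v) k = c ^ mdeg k * mpow v k := by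
  simp [mpow, mdeg, mul_pow, Finset.prod_mul_distrib, Finset.prod_pow_eq_pow_sum]

lemma abs_mpow_le (v : Ed d) (k : MIdx d) : |mpow v k| ≤ ‖v‖ ^ mdeg k := by
  unfold mpow mdeg
  rw [Finset.abs_prod, ← Finset.prod_pow_eq_pow_sum]
  refine Finset.prod_le_prod (fun _ _ => abs_nonneg _) (fun i _ => ?_)
  rw [abs_pow]
  exact pow_le_pow_left₀ (abs_nonneg _) (PiLp.norm_apply_le v i) _

lemma continuous_mpow (k : MIdx d) : Continuous (fun v : Ed d => mpow v k) := by
  unfold mpow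
  fun_prop

def Dj (j : ℕ) (f : Ed d → ℝ) (x v : Ed d) : ℝ :=
  ∑ s : Fin j → Fin d, mpow v (cnt s) * mderiv (cnt s) f x

lemma Dj_succ (j : ℕ) (f : Ed d → ℝ) (x v : Ed d) :
    Dj (j + 1) f x v = ∑ s : Fin j → Fin d, mpow v (cnt s) *
      ∑ i, v i * mderiv (cnt s + sg i) f x := by
  unfold Dj
  rw [← (Fin.consEquiv (fun _ : Fin (j+1) => Fin d)).sum_comp]
  rw [Fintype.sum_prod_type_right]
  refine Finset.sum_congr rfl fun s _ => ?_
  rw [Finset.mul_sum]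
  refine Finset.sum_congr rfl fun i _ => ?_
  have : cnt (Fin.consEquiv (fun _ : Fin (j+1) => Fin d) (i, s)) = cnt s + sg i := by
    simp [cnt, Fin.sum_univ_succ, Fin.consEquiv, add_comm]
  rw [this, mpow_add, mpow_sg]
  ring

lemma Dj_hasDerivAt {N j : ℕ} {f : Ed d → ℝ} (hf : IsCr N f) (hj : j < N) (x v : Ed d) (t : ℝ) :
    HasDerivAt (fun t : ℝ => Dj j f (x + t • v) v) (Dj (j+1) f (x + t • v) v) t := by
  rw [Dj_succ]
  unfold Dj
  refine HasDerivAt.fun_sum fun s _ => ?_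
  refine HasDerivAt.const_mul _ ?_
  refine hasDerivAt_line (D := fun x => ∑ i, v i * mderiv (cnt s + sg i) f x) (fun x => ?_) x t
  refine hasLineDerivAt_sum (D := fun i => mderiv (cnt s + sg i) f) (fun i x => ?_) (fun i => ?_) v x
  · exact hf.hasLineDerivAt _ (by rw [mdeg_cnt]; exact hj) i x
  · exact (hf _ (by rw [mdeg_add_sg, mdeg_cnt]; omega)).1

lemma taylor_1d (N : ℕ) : ∀ (h : ℕ → ℝ → ℝ) (B : ℝ),
    (∀ j < N, ∀ t, HasDerivAt (h j) (h (j+1) t) t) →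
    (∀ t ∈ Set.Icc (0:ℝ) 1, |h N t| ≤ B) →
    ∀ t ∈ Set.Icc (0:ℝ) 1,
      |h 0 t - ∑ j ∈ Finset.range N, t ^ j / (j.factorial : ℝ) * h j 0| ≤ B := by
  induction N with
  | zero => intro h B _ hB t ht; simpa using hB t ht
  | succ N ih =>
    intro h B hd hB t ht
    have ih' := ih (fun j => h (j+1)) B (fun j hj t => hd (j+1) (by omega) t) hB
    have hderiv : ∀ s, HasDerivAt (fun s => h 0 s - ∑ j ∈ Finset.range (N+1), s ^ j / (j.factorial : ℝ) * h j 0)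
        (h 1 s - ∑ j ∈ Finset.range N, s ^ j / (j.factorial : ℝ) * h (j+1) 0) s := by
      intro s
      refine (hd 0 (by omega) s).fun_sub ?_
      simp only [Finset.sum_range_succ' _ N]
      have h0 : HasDerivAt (fun s : ℝ => s ^ 0 / (Nat.factorial 0 : ℝ) * h 0 0) 0 s := by
        simpa using hasDerivAt_const s (h 0 0)
      rw [← add_zero (∑ j ∈ Finset.range N, s ^ j / (j.factorial : ℝ) * h (j+1) 0)]
      refine HasDerivAt.fun_add (HasDerivAt.fun_sum fun j _ => ?_) h0
      refine HasDerivAt.mul_const ?_ _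
      have := (hasDerivAt_pow (j+1) s).div_const ((j+1).factorial : ℝ)
      have e : s ^ j / (j.factorial : ℝ) = ((j+1 : ℕ) : ℝ) * s ^ (j + 1 - 1) / ((j+1).factorial : ℝ) := by
        rw [Nat.factorial_succ]
        push_cast
        have : (j.factorial : ℝ) ≠ 0 := by positivity
        field_simp
      rw [e]
      exact this
    have hmv := norm_image_sub_le_of_norm_deriv_le_segment_01' (C := B)
      (f := fun s => h 0 (s * t) - ∑ j ∈ Finset.range (N+1), (s*t) ^ j / (j.factorial : ℝ) * h j 0)
      (f' := fun s => (h 1 (s*t) - ∑ j ∈ Finset.range N, (s*t) ^ j / (j.factorial : ℝ) * h (j+1) 0) * t)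
      (fun s _ => by
        have := HasDerivAt.comp s (hderiv (s*t)) (hasDerivAt_mul_const t)
        exact this.hasDerivWithinAt)
      (fun s hs => by
        have hst : s * t ∈ Set.Icc (0:ℝ) 1 := ⟨mul_nonneg hs.1 ht.1, by nlinarith [hs.1, hs.2, ht.1, ht.2]⟩
        have := ih' (s*t) hst
        rw [Real.norm_eq_abs, abs_mul, abs_of_nonneg ht.1]
        have hB0 : 0 ≤ B := (abs_nonneg _).trans this
        calc _ ≤ B * 1 := mul_le_mul this ht.2 ht.1 hB0
          _ = B := mul_one B)
    simp only [one_mul, zero_mul] at hmv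
    have e0 : h 0 0 - ∑ j ∈ Finset.range (N+1), (0:ℝ) ^ j / (j.factorial : ℝ) * h j 0 = 0 := by
      rw [Finset.sum_range_succ']
      simp
    rw [e0, sub_zero] at hmv
    exact hmv

lemma Dj_bound (N : ℕ) (f : Ed d → ℝ) (x v : Ed d) (M : ℝ)
    (h : ∀ k, mdeg k = N → |mderiv k f x| ≤ M) : |Dj N f x v| ≤ (d:ℝ) ^ N * (‖v‖ ^ N * M) := by
  unfold Dj
  refine (Finset.abs_sum_le_sum_abs _ _).trans ?_
  refine (Finset.sum_le_card_nsmul _ _ (‖v‖ ^ N * M) fun s _ => ?_).trans ?_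
  · rw [abs_mul]
    have h1 := abs_mpow_le v (cnt s)
    rw [mdeg_cnt] at h1
    exact mul_le_mul h1 (h _ (mdeg_cnt s)) (abs_nonneg _) (by positivity)
  · simp

lemma taylor {N : ℕ} {f : Ed d → ℝ} (hf : IsCr N f) (x v : Ed d) (M : ℝ)
    (h : ∀ t ∈ Set.Icc (0:ℝ) 1, ∀ k, mdeg k = N → |mderiv k f (x + t • v)| ≤ M) :
    |f (x + v) - ∑ j ∈ Finset.range N, 1 / (j.factorial : ℝ) * Dj j f x v| ≤
      (d:ℝ) ^ N * (‖v‖ ^ N * M) := by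
  have := taylor_1d N (fun j t => Dj j f (x + t • v) v) ((d:ℝ) ^ N * (‖v‖ ^ N * M))
    (fun j hj t => Dj_hasDerivAt hf hj x v t) (fun t ht => Dj_bound N f _ v M (h t ht)) 1 (by simp)
  have e0 : Dj 0 f (x + (1:ℝ) • v) v = f (x + v) := by
    simp [Dj, cnt, mderiv_zero, mpow]
  rw [e0] at this
  simpa using this

lemma kstar_setIntegral {w : Ed d → ℝ} (G : Ed d → Ed d → ℝ) (y : Ed d) :
    kstar G w y = ∫ x in tsupport w, w x * G x y := by
  unfold kstar
  symm
  apply setIntegral_eq_integral_of_forall_compl_eq_zero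
  intro x hx
  rw [image_eq_zero_of_notMem_tsupport hx, zero_mul]

lemma kstar_isCr {r : ℕ} {w : Ed d → ℝ} {G : Ed d → Ed d → ℝ} (hw : Continuous w)
    (hwc : HasCompactSupport w) (hG : ∀ x, IsCr r (G x))
    (hGc : ∀ l, mdeg l ≤ r → Continuous (fun p : Ed d × Ed d => mderiv l (G p.1) p.2)) :
    IsCr r (kstar G w) ∧
      ∀ k, mdeg k ≤ r → mderiv k (kstar G w) = kstar (fun x y => mderiv k (G x) y) w := by
  refine isCr_of (fun k => kstar (fun x y => mderiv k (G x) y) w) (by simp [mderiv_zero]) ?_ ?_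
  · intro k hk
    have h := hGc k hk
    have e : kstar (fun x y => mderiv k (G x) y) w =
        fun y => ∫ x in tsupport w, w x * mderiv k (G x) y := by
      funext y; exact kstar_setIntegral _ y
    rw [e]
    refine continuous_parametric_integral_of_continuous (f := fun y x => w x * mderiv k (G x) y) ?_ hwc
    exact (hw.comp continuous_snd).mul (h.comp continuous_swap)
  · intro k hk i x
    have h := hGc k hk.le
    have h' := hGc (k + sg i) (by rw [mdeg_add_sg]; omega)
    simp only [kstar_setIntegral]
    have := hasDerivAt_setIntegral (volume : Measure (Ed d)) hwc (isClosed_tsupport w).measurableSet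
      (f := fun t a => w a * mderiv k (G a) (x + t • ee i))
      (f' := fun t a => w a * mderiv (k + sg i) (G a) (x + t • ee i))
      (by
        have : Continuous (fun p : ℝ × Ed d => (p.2, x + p.1 • ee i)) := by fun_prop
        exact (hw.comp continuous_snd).mul (h.comp this))
      (by
        have : Continuous (fun p : ℝ × Ed d => (p.2, x + p.1 • ee i)) := by fun_prop
        exact (hw.comp continuous_snd).mul (h'.comp this))
      (fun t a => by
        refine HasDerivAt.const_mul _ ?_
        exact hasDerivAt_line (fun x => (hG a).hasLineDerivAt k hk i x) x t) 0
    simp only [zero_smul, add_zero] at this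
    unfold HasLineDerivAt
    have e : (fun t : ℝ => kstar (fun x y => mderiv k (G x) y) w (x + t • ee i)) =
        fun t : ℝ => ∫ a in tsupport w, w a * mderiv k (G a) (x + t • ee i) := by
      funext t; rw [kstar_setIntegral]
    rw [e]
    exact this

def moll (w g : Ed d → ℝ) : Ed d → ℝ := kstar (fun x y => g (y - x)) w

lemma moll_eq_conv (w g : Ed d → ℝ) :
    moll w g = MeasureTheory.convolution w g (ContinuousLinearMap.lsmul ℝ ℝ) volume := by
  funext y
  simp [moll, kstar, MeasureTheory.convolution]

lemma moll_isCr {r : ℕ} {w g : Ed d → ℝ} (hw : Continuous w) (hwc : HasCompactSupport w)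
    (hg : IsCr r g) :
    ∀ k, mdeg k ≤ r → mderiv k (moll w g) = moll w (mderiv k g) := by
  have hsh : ∀ k, mdeg k ≤ r →
      Continuous (fun p : Ed d × Ed d => mderiv k (fun y => g (y - p.1)) p.2) := by
    intro k hk
    have := (hg k hk).1
    simp only [mderiv_shift]
    fun_prop
  have h := (kstar_isCr (r := r) (G := fun x y => g (y - x)) hw hwc (fun x => ?_) hsh).2
  · intro k hk
    unfold moll
    rw [h k hk]
    simp only [mderiv_shift]
  · intro k hk
    have h1 := (hg k hk)
    refine ⟨?_, fun hk' i y => ?_⟩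
    · have := h1.1
      rw [mderiv_shift]; fun_prop
    · rw [mderiv_shift]
      have h2 := h1.2 hk' i (y - x)
      unfold LineDifferentiableAt at h2 ⊢
      have e : (fun t : ℝ => mderiv k g (y + t • EuclideanSpace.single i (1:ℝ) - x)) =
         fun t : ℝ => mderiv k g (y - x + t • EuclideanSpace.single i (1:ℝ)) := by
        funext t; congr 1; abel
      rw [e]
      exact h2

lemma crNorm_le {r : ℕ} {g : Ed d → ℝ} {δ : ℝ} (hδ : 0 ≤ δ)
    (h : ∀ k, mdeg k ≤ r → ∀ x, |mderiv k g x| ≤ δ) : crNorm r g ≤ δ := by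
  unfold crNorm
  exact Real.iSup_le (fun k => Real.iSup_le (fun x => h k.1 k.2 x) hδ) hδ

lemma finite_mdeg (r : ℕ) : {k : MIdx d | mdeg k ≤ r}.Finite := by
  refine (Set.finite_Iic (fun _ : Fin d => r)).subset ?_
  intro k hk i
  have : k i ≤ mdeg k := Finset.single_le_sum (f := k) (fun _ _ => Nat.zero_le _) (Finset.mem_univ i)
  exact this.trans hk

lemma hasCompactSupport_of_ball {g : Ed d → ℝ} {x : Ed d} {R : ℝ}
    (h : ∀ y, y ∉ closedBall x R → g y = 0) : HasCompactSupport g :=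
  HasCompactSupport.intro (isCompact_closedBall x R) h

lemma tsupport_of_ball {g : Ed d → ℝ} {x : Ed d} {R : ℝ}
    (h : ∀ y, y ∉ closedBall x R → g y = 0) : tsupport g ⊆ closedBall x R := by
  refine closure_minimal ?_ isClosed_closedBall
  intro y hy
  by_contra hc
  exact hy (h y hc)

lemma moll_abs_le {w h : Ed d → ℝ} {M : ℝ} (hw0 : ∀ x, 0 ≤ w x) (hwi : Integrable w)
    (hw1 : ∫ x, w x = 1) (hM : ∀ y, |h y| ≤ M) (y : Ed d) : |moll w h y| ≤ M := by
  unfold moll kstar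
  rw [← Real.norm_eq_abs]
  refine (norm_integral_le_of_norm_le (hwi.mul_const M) (Eventually.of_forall fun x => ?_)).trans ?_
  · rw [Real.norm_eq_abs, abs_mul, abs_of_nonneg (hw0 x)]
    exact mul_le_mul_of_nonneg_left (hM _) (hw0 x)
  · rw [integral_mul_const, hw1, one_mul]

lemma ext_bound {f : DFunc d} {r : ℕ} (hf : OrderExt f r) {x : Ed d} {R l A B : ℝ} (hR : 0 < R)
    (hl : l = 2 * R) (hA : 0 < A) {g : Ed d → ℝ} (hg : IsCr r g)
    (hs : ∀ y, y ∉ closedBall x R → g y = 0)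
    (hb : ∀ k, mdeg k ≤ r → ∀ y, |mderiv k g y| ≤ A * ((l ^ d)⁻¹ * (l⁻¹) ^ mdeg k))
    (ht : ∀ φ ∈ TB d r, |f (scTF φ x l)| ≤ B) : |f g| ≤ A * B := by
  have hl0 : 0 < l := by rw [hl]; linarith
  obtain ⟨hadd, hsmul, hbd⟩ := hf
  obtain ⟨C, hC⟩ := hbd (closedBall x l) (isCompact_closedBall x l)
  have hgc := hasCompactSupport_of_ball hs
  suffices H : ∀ δ : ℝ, 0 < δ → |f g| ≤ A * B + |C| * δ by
    have lim : Tendsto (fun δ : ℝ => A * B + |C| * δ) (𝓝[>] 0) (𝓝 (A * B)) := by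
      have : Continuous (fun δ : ℝ => A * B + |C| * δ) := by fun_prop
      have := (this.tendsto 0).mono_left (nhdsWithin_le_nhds (s := Set.Ioi 0))
      simpa using this
    refine ge_of_tendsto lim ?_
    filter_upwards [self_mem_nhdsWithin] with δ hδ using H δ hδ
  intro δ hδ
  -- choose ε
  have hev : ∀ᶠ ε : ℝ in 𝓝[>] 0, ∀ k ∈ {k : MIdx d | mdeg k ≤ r}, ∀ a b : Ed d, dist a b < ε →
      dist (mderiv k g a) (mderiv k g b) ≤ δ := by
    rw [(finite_mdeg r).eventually_all]
    intro k hk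
    have hu : UniformContinuous (mderiv k g) := by
      refine HasCompactSupport.uniformContinuous_of_continuous ?_ (hg k hk).1
      exact hasCompactSupport_of_ball (x := x) (R := R)
        (mderiv_zero_on isClosed_closedBall.isOpen_compl (fun y hy => hs y hy) k)
    obtain ⟨ε, hε, h⟩ := Metric.uniformContinuous_iff.1 hu δ hδ
    have : ∀ᶠ e : ℝ in 𝓝[>] 0, e < ε := by
      exact nhdsWithin_le_nhds (Iio_mem_nhds hε)
    filter_upwards [this] with e he a b hab
    exact (h (hab.trans he)).le
  have hev2 : ∀ᶠ e : ℝ in 𝓝[>] 0, e < R := nhdsWithin_le_nhds (Iio_mem_nhds hR)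
  obtain ⟨ε, ⟨h1, h2⟩, hε⟩ := ((hev.and hev2).and self_mem_nhdsWithin).exists
  have hε0 : 0 < ε := hε
  let φ : ContDiffBump (0 : Ed d) := ⟨ε / 2, ε, by linarith, by linarith⟩
  set w : Ed d → ℝ := φ.normed volume with hw
  have hwc : HasCompactSupport w := φ.hasCompactSupport_normed
  have hws : ContDiff ℝ (⊤ : ℕ∞) w := φ.contDiff_normed
  have hw0 : ∀ x, 0 ≤ w x := φ.nonneg_normed
  have hwi : Integrable w := φ.integrable_normed
  have hw1 : ∫ x, w x = 1 := φ.integral_normed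
  have hwsupp : ∀ x, w x ≠ 0 → dist x 0 < ε := by
    intro x hx
    have : x ∈ Function.support w := hx
    rw [hw, φ.support_normed_eq] at this
    exact this
  have hgs : ContDiff ℝ (⊤ : ℕ∞) (moll w g) := by
    rw [moll_eq_conv]
    exact hwc.contDiff_convolution_left _ hws hg.continuous.locallyIntegrable
  have hgsupp : ∀ y, y ∉ closedBall x l → moll w g y = 0 := by
    intro y hy
    unfold moll kstar
    refine integral_eq_zero_of_ae (Eventually.of_forall fun a => ?_)
    by_cases ha : w a = 0
    · simp [ha]
    · have h3 := hwsupp a ha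
      have : g (y - a) = 0 := by
        apply hs
        intro hcon
        apply hy
        rw [mem_closedBall] at hcon ⊢
        have : dist y x ≤ dist (y - a) x + dist a 0 := by
          rw [dist_eq_norm, dist_eq_norm, dist_eq_norm]
          have : y - x = (y - a - x) + (a - 0) := by abel
          rw [this]; exact norm_add_le _ _
        linarith
      simp [this]
  have hgm := moll_isCr hws.continuous hwc hg
  have hgsr : IsCr r (moll w g) := isCr_of_contDiff hgs r
  have hgsc := hasCompactSupport_of_ball hgsupp
  -- difference
  obtain ⟨hdr, hdm⟩ := hg.sub hgsr
  have hdiff : |f (g - moll w g)| ≤ |C| * δ := by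
    have hsup : ∀ y, y ∉ closedBall x l → (g - moll w g) y = 0 := by
      intro y hy
      have : g y = 0 := hs y (fun h => hy (closedBall_subset_closedBall (by linarith) h))
      simp [this, hgsupp y hy]
    refine (hC _ hdr (hasCompactSupport_of_ball hsup) (tsupport_of_ball hsup)).trans ?_
    have hcr : crNorm r (g - moll w g) ≤ δ := by
      refine crNorm_le hδ.le fun k hk y => ?_
      rw [hdm k hk, hgm k hk, Pi.sub_apply, ← Real.dist_eq, dist_comm, moll_eq_conv]
      exact φ.dist_normed_convolution_le (hg k hk).1.aestronglyMeasurable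
        (fun z hz => h1 k hk z y hz)
    have hcr0 : 0 ≤ crNorm r (g - moll w g) :=
      Real.iSup_nonneg fun k => Real.iSup_nonneg fun x => abs_nonneg _
    exact mul_le_mul (le_abs_self C) hcr hcr0 (abs_nonneg C)
  -- main
  let η : Ed d → ℝ := fun z => (A⁻¹ * l ^ d) * moll w g (x + l • z)
  have hηs : ContDiff ℝ (⊤ : ℕ∞) η := by
    have : ContDiff ℝ (⊤ : ℕ∞) (fun z : Ed d => moll w g (x + l • z)) :=
      hgs.comp (by fun_prop)
    exact contDiff_const.mul this
  have hηsupp : ∀ z, z ∉ closedBall (0 : Ed d) 1 → η z = 0 := by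
    intro z hz
    have : moll w g (x + l • z) = 0 := by
      apply hgsupp
      intro hcon
      apply hz
      rw [mem_closedBall, dist_eq_norm] at hcon ⊢
      rw [add_sub_cancel_left, norm_smul, Real.norm_eq_abs, abs_of_pos hl0] at hcon
      rw [sub_zero]
      exact le_of_mul_le_mul_left (by simpa using hcon) hl0
    simp [η, this]
  have hηTB : η ∈ TB d r := by
    refine ⟨⟨hηs, hasCompactSupport_of_ball hηsupp⟩, tsupport_of_ball hηsupp, fun k hk z => ?_⟩
    simp only [η]
    rw [mderiv_scale, hgm k hk, abs_mul, abs_of_nonneg (by positivity)]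
    have := moll_abs_le hw0 hwi hw1 (hb k hk) (x + l • z)
    refine (mul_le_mul_of_nonneg_left this (by positivity)).trans ?_
    rw [inv_pow]
    apply le_of_eq
    field_simp
  have hfeq : moll w g = A • scTF η x l := by
    funext y
    simp only [Pi.smul_apply, scTF, η, smul_eq_mul]
    rw [smul_smul, mul_inv_cancel₀ hl0.ne', one_smul, add_sub_cancel]
    field_simp
  have hmain : |f (moll w g)| ≤ A * B := by
    have hts := isTest_scTF hηTB.1 x hl0
    rw [hfeq, hsmul A _ (isCr_of_contDiff hts.1 r) hts.2, abs_mul, abs_of_pos hA]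
    exact mul_le_mul_of_nonneg_left (ht η hηTB) hA.le
  have hsplit : f g = f (moll w g) + f (g - moll w g) := by
    rw [← hadd _ _ hgsr hgsc hdr (hgc.sub hgsc)]
    congr 1
    abel
  rw [hsplit]
  exact (abs_add_le _ _).trans (add_le_add hmain hdiff)

lemma IsCmr.cont {m r : ℕ} {G : Ed d → Ed d → ℝ} (h : IsCmr m r G) (l : MIdx d) (hl : mdeg l ≤ r) :
    Continuous (fun p : Ed d × Ed d => mderiv l (G p.1) p.2) := by
  have := (h 0 l (by simp [mdeg_zero]) hl).1
  simp only [mixDeriv, mderiv_zero] at this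
  exact this

lemma IsCmr.isCr_right {m r : ℕ} {G : Ed d → Ed d → ℝ} (h : IsCmr m r G) (x : Ed d) :
    IsCr r (G x) := by
  intro l hl
  refine ⟨?_, fun hl' i y => ?_⟩
  · have hc := h.cont l hl
    exact hc.comp (Continuous.prodMk_right x)
  · exact (h 0 l (by simp [mdeg_zero]) hl).2.2 hl' i x y

lemma IsCmr.isCr_left {m r : ℕ} {G : Ed d → Ed d → ℝ} (h : IsCmr m r G) (l : MIdx d)
    (hl : mdeg l ≤ r) (y : Ed d) : IsCr m (fun x => mderiv l (G x) y) := by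
  intro k hk
  refine ⟨?_, fun hk' i x => ?_⟩
  · have hc := (h k l hk hl).1
    exact hc.comp (Continuous.prodMk_left y)
  · exact (h k l hk hl).2.1 hk' i x y

lemma abs_integral_ball_le {h : Ed d → ℝ} {c : Ed d} {R M : ℝ} (hR : 0 ≤ R)
    (h0 : ∀ a, a ∉ closedBall c R → h a = 0) (hM : ∀ a ∈ closedBall c R, |h a| ≤ M) :
    |∫ a, h a| ≤ M * (R ^ d * volume.real (closedBall (0 : Ed d) 1)) := by
  rw [← setIntegral_eq_integral_of_forall_compl_eq_zero (s := closedBall c R) (fun a ha => h0 a ha)]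
  have := norm_setIntegral_le_of_norm_le_const (μ := (volume : Measure (Ed d)))
    (s := closedBall c R) (f := h) (C := M) measure_closedBall_lt_top hM
  rw [Real.norm_eq_abs] at this
  refine this.trans (le_of_eq ?_)
  congr 1
  rw [measureReal_def, Measure.addHaar_closedBall' _ _ hR, ENNReal.toReal_mul,
    ENNReal.toReal_ofReal (by positivity), measureReal_def]
  simp

lemma integral_poly {h : Ed d → ℝ} (hc : Continuous h) (hs : HasCompactSupport h) (N : ℕ)
    (f : Ed d → ℝ) (y : Ed d) :
    (∫ x, h x * ∑ j ∈ Finset.range N, 1 / (j.factorial : ℝ) * Dj j f y (x - y)) =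
    ∑ j ∈ Finset.range N, 1 / (j.factorial : ℝ) * ∑ s : Fin j → Fin d,
      mderiv (cnt s) f y * ∫ x, h x * mpow (x - y) (cnt s) := by
  have hintg : ∀ k : MIdx d, Integrable (fun x => h x * mpow (x - y) k) := by
    intro k
    have h1 := continuous_mpow k
    exact Continuous.integrable_of_hasCompactSupport (by fun_prop) hs.mul_right
  have e : ∀ x, h x * ∑ j ∈ Finset.range N, 1 / (j.factorial : ℝ) * Dj j f y (x - y) =
      ∑ j ∈ Finset.range N, 1 / (j.factorial : ℝ) * ∑ s : Fin j → Fin d,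
      mderiv (cnt s) f y * (h x * mpow (x - y) (cnt s)) := by
    intro x
    simp only [Dj, Finset.mul_sum]
    refine Finset.sum_congr rfl fun j _ => Finset.sum_congr rfl fun s _ => ?_
    ring
  simp only [e]
  rw [integral_finset_sum]
  · refine Finset.sum_congr rfl fun j _ => ?_
    rw [integral_const_mul]
    congr 1
    rw [integral_finset_sum]
    · refine Finset.sum_congr rfl fun s _ => ?_
      rw [integral_const_mul]
    · intro s _
      exact (hintg _).const_mul _
  · intro j _
    refine Integrable.const_mul ?_ _
    exact integrable_finset_sum _ fun s _ => (hintg _).const_mul _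

lemma continuous_Dj (j : ℕ) (f : Ed d → ℝ) (y : Ed d) : Continuous (fun x => Dj j f y (x - y)) := by
  unfold Dj
  refine continuous_finset_sum _ fun s _ => ?_
  have := continuous_mpow (cnt s)
  fun_prop

lemma kstar_deriv {β ρ : ℝ} {m r : ℕ} {Kn : ℕ → Ed d → Ed d → ℝ} (hK : RegKer d β m r ρ Kn)
    (n : ℕ) {ψ : Ed d → ℝ} (hψ : IsTest ψ) :
    IsCr r (kstar (Kn n) ψ) ∧ ∀ k, mdeg k ≤ r → ∀ y,
      mderiv k (kstar (Kn n) ψ) y = ∫ x, ψ x * mderiv k (Kn n x) y := by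
  have h := kstar_isCr (r := r) (G := Kn n) hψ.1.continuous hψ.2 (fun x => (hK.1 n).isCr_right x)
    (fun l hl => (hK.1 n).cont l hl)
  refine ⟨h.1, fun k hk y => ?_⟩
  rw [h.2 k hk]
  rfl

lemma ker_deriv_zero {β ρ : ℝ} {m r : ℕ} {Kn : ℕ → Ed d → Ed d → ℝ} (hK : RegKer d β m r ρ Kn)
    (n : ℕ) (k : MIdx d) (x y : Ed d) (h : x ∉ closedBall y (ρ * 2 ^ (-(n : ℝ)))) :
    mderiv k (Kn n x) y = 0 := by
  have hopen : IsOpen {y : Ed d | ρ * 2 ^ (-(n : ℝ)) < dist x y} :=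
    isOpen_lt continuous_const (by fun_prop)
  refine mderiv_zero_on hopen (fun z hz => ?_) k y ?_
  · by_contra hcon
    exact absurd (hK.2.1 n x z hcon) (not_le.2 hz)
  · simpa [mem_closedBall] using h

lemma mpow_neg_abs (v w : Ed d) (k : MIdx d) : mpow (v - w) k = (-1) ^ mdeg k * mpow (w - v) k := by
  rw [← mpow_smul]
  congr 1
  simp

lemma bound_B {β ρ : ℝ} {m r : ℕ} {Kn : ℕ → Ed d → Ed d → ℝ} (hρ : 0 < ρ)
    (hK : RegKer d β m r ρ Kn)
    {K1 : Set (Ed d)} (hK1 : IsCompact K1) : ∃ C : ℝ, 0 < C ∧ ∀ n (ψ : Ed d → ℝ), IsTest ψ →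
      ∀ (M : ℝ) (k : MIdx d), mdeg k ≤ r →
      (∀ l, mdeg l ≤ mdeg k → ∀ x, |mderiv l ψ x| ≤ M) → ∀ y ∈ K1,
      |mderiv k (kstar (Kn n) ψ) y| ≤ C * M * 2 ^ (-(β * (n : ℝ))) := by
  obtain ⟨c, hc, hc1, hc2⟩ := hK.2.2 (cthickening ρ K1) hK1.cthickening
  set V := volume.real (closedBall (0 : Ed d) 1) with hV
  have hV0 : 0 ≤ V := measureReal_nonneg
  refine ⟨c * (∑ j ∈ Finset.range r, (d:ℝ) ^ j) + c * ((1 + d) ^ r * (1 + ρ) ^ (r + d) * V) + 1,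
    by positivity, ?_⟩
  intro n ψ hψ M k hk hM y hy
  have hyK : y ∈ cthickening ρ K1 := self_subset_cthickening K1 hy
  have hM0 : 0 ≤ M := (abs_nonneg _).trans (hM 0 (by simp [mdeg_zero]) 0)
  rw [(kstar_deriv hK n hψ).2 k hk y]
  set N := mdeg k with hN
  set G : Ed d → ℝ := fun x => mderiv k (Kn n x) y with hG
  have hGc : Continuous G := ((hK.1 n).isCr_left k hk y).continuous
  set R := ρ * (2:ℝ) ^ (-(n : ℝ)) with hR
  have hR0 : 0 ≤ R := by positivity
  have hRρ : R ≤ ρ := by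
    have : (2:ℝ) ^ (-(n : ℝ)) ≤ 1 :=
      Real.rpow_le_one_of_one_le_of_nonpos (by norm_num) (by simp)
    calc R ≤ ρ * 1 := by rw [hR]; gcongr
      _ = ρ := mul_one ρ
  have hGs : ∀ x, x ∉ closedBall y R → G x = 0 := fun x hx => ker_deriv_zero hK n k x y hx
  have hGcs : HasCompactSupport G := hasCompactSupport_of_ball hGs
  set P : Ed d → ℝ := fun x => ∑ j ∈ Finset.range N, 1 / (j.factorial : ℝ) * Dj j ψ y (x - y) with hP
  have hPc : Continuous P := by
    refine continuous_finset_sum _ fun j _ => ?_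
    exact continuous_const.mul (continuous_Dj j ψ y)
  have hψc := hψ.1.continuous
  set E := (2:ℝ) ^ (-(β * (n : ℝ))) with hE
  have hE0 : 0 < E := by positivity
  have hsplit : (∫ x, ψ x * G x) = (∫ x, (ψ x - P x) * G x) + ∫ x, G x * P x := by
    rw [← integral_add]
    · congr 1; funext x; ring
    · exact Continuous.integrable_of_hasCompactSupport (by fun_prop) hGcs.mul_left
    · exact Continuous.integrable_of_hasCompactSupport (by fun_prop) hGcs.mul_right
  have hpart2 : |∫ x, G x * P x| ≤ c * (∑ j ∈ Finset.range r, (d:ℝ) ^ j) * M * E := by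
    rw [hP, integral_poly hGc hGcs]
    refine (Finset.abs_sum_le_sum_abs _ _).trans ?_
    have h1 : ∀ j ∈ Finset.range N, |1 / (j.factorial : ℝ) * ∑ s : Fin j → Fin d,
        mderiv (cnt s) ψ y * ∫ x, G x * mpow (x - y) (cnt s)| ≤ (d:ℝ) ^ j * (M * (c * E)) := by
      intro j hj
      rw [Finset.mem_range] at hj
      rw [abs_mul]
      have hf : |1 / (j.factorial : ℝ)| ≤ 1 := by
        rw [abs_of_nonneg (by positivity)]
        refine (div_le_one (by positivity)).2 ?_
        exact_mod_cast Nat.factorial_pos j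
      refine (mul_le_of_le_one_left (abs_nonneg _) hf).trans ?_
      refine (Finset.abs_sum_le_sum_abs _ _).trans ?_
      refine (Finset.sum_le_card_nsmul _ _ (M * (c * E)) fun s _ => ?_).trans (by simp)
      rw [abs_mul]
      refine mul_le_mul (hM _ (by rw [mdeg_cnt]; exact hj.le) y) ?_ (abs_nonneg _) hM0
      have h2 := hc2 n k (cnt s) hk (by rw [mdeg_cnt]; omega) y hyK
      have h3 : (∫ x, G x * mpow (x - y) (cnt s)) =
          (-1) ^ mdeg (cnt s) * ∫ x, mpow (y - x) (cnt s) * mderiv k (fun y' => Kn n x y') y := by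
        rw [← integral_const_mul]
        congr 1
        funext x
        rw [mpow_neg_abs x y, hG]
        ring
      rw [h3, abs_mul, abs_pow, abs_neg, abs_one, one_pow, one_mul]
      exact h2
    refine (Finset.sum_le_sum h1).trans ?_
    rw [← Finset.sum_mul]
    have h4 : ∑ j ∈ Finset.range N, (d:ℝ) ^ j ≤ ∑ j ∈ Finset.range r, (d:ℝ) ^ j :=
      Finset.sum_le_sum_of_subset_of_nonneg (Finset.range_mono hk) (fun _ _ _ => by positivity)
    calc _ ≤ (∑ j ∈ Finset.range r, (d:ℝ) ^ j) * (M * (c * E)) := by gcongr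
      _ = _ := by ring
  have hpart1 : |∫ x, (ψ x - P x) * G x| ≤ c * ((1 + d) ^ r * (1 + ρ) ^ (r + d) * V) * M * E := by
    set Q := (2:ℝ) ^ ((((d : ℝ) - β + (mdeg k : ℝ) + (mdeg (0 : MIdx d) : ℝ))) * n) with hQ
    have hb : ∀ a ∈ closedBall y R, |(ψ a - P a) * G a| ≤ ((d:ℝ) ^ N * (R ^ N * M)) * (c * Q) := by
      intro a ha
      rw [abs_mul]
      have haR : ‖a - y‖ ≤ R := by rwa [mem_closedBall, dist_eq_norm] at ha
      have t1 := taylor (isCr_of_contDiff hψ.1 N) y (a - y) M (fun t _ l hl => hM l hl.le _)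
      rw [add_sub_cancel] at t1
      have t2 : |G a| ≤ c * Q := by
        have haK : a ∈ cthickening ρ K1 := by
          refine closedBall_subset_cthickening hy ρ ?_
          exact closedBall_subset_closedBall hRρ ha
        have := hc1 n 0 k (by simp [mdeg_zero]) hk a haK y hyK
        simp only [mixDeriv, mderiv_zero] at this
        exact this
      refine mul_le_mul (t1.trans ?_) t2 (abs_nonneg _) (by positivity)
      gcongr
    have h5 := abs_integral_ball_le (h := fun x => (ψ x - P x) * G x) hR0
      (fun a ha => by rw [hGs a ha, mul_zero]) hb
    refine h5.trans ?_
    have hq : R ^ (N + d) * Q = ρ ^ (N + d) * E := by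
      rw [hR, mul_pow, mul_assoc]
      congr 1
      rw [hQ, hE, ← Real.rpow_natCast, ← Real.rpow_mul (by norm_num), ← Real.rpow_add (by norm_num)]
      congr 1
      rw [mdeg_zero, ← hN]
      push_cast
      ring
    have e1 : ((d:ℝ) ^ N * (R ^ N * M)) * (c * Q) * (R ^ d * V) =
        c * ((d:ℝ) ^ N * ρ ^ (N + d) * V) * M * E := by
      calc _ = c * ((d:ℝ) ^ N * V) * M * (R ^ (N + d) * Q) := by ring
        _ = _ := by rw [hq]; ring
    rw [e1]
    have f1 : (d:ℝ) ^ N ≤ (1 + d) ^ r :=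
      calc (d:ℝ) ^ N ≤ (1 + d) ^ N := by gcongr; linarith
        _ ≤ (1 + d) ^ r := pow_le_pow_right₀ (by simp) hk
    have f2 : ρ ^ (N + d) ≤ (1 + ρ) ^ (r + d) :=
      calc ρ ^ (N + d) ≤ (1 + ρ) ^ (N + d) := by gcongr; linarith
        _ ≤ (1 + ρ) ^ (r + d) := pow_le_pow_right₀ (by linarith) (by omega)
    gcongr
  rw [hsplit]
  refine (abs_add_le _ _).trans ?_
  have : 0 ≤ M * E := by positivity
  nlinarith [hpart1, hpart2]

lemma moment_scTF {φ : Ed d → ℝ} (x : Ed d) {l : ℝ} (hl : 0 < l) (k : MIdx d)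
    (h : (∫ z, φ z * mpow z k) = 0) : (∫ a, scTF φ x l a * mpow (a - x) k) = 0 := by
  let H : Ed d → ℝ := fun z => (l ^ d)⁻¹ * l ^ mdeg k * (φ z * mpow z k)
  have e : (fun a => scTF φ x l a * mpow (a - x) k) = fun a => (fun u => H (l⁻¹ • u)) (a - x) := by
    funext a
    simp only [scTF, H, mpow_smul]
    have : l ^ mdeg k ≠ 0 := by positivity
    rw [inv_pow]
    field_simp
  rw [e, integral_sub_right_eq_self (fun u => H (l⁻¹ • u)), Measure.integral_comp_inv_smul]
  simp only [H]
  rw [integral_const_mul, h]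
  simp

lemma scTF_zero_off {φ : Ed d → ℝ} (hφ : tsupport φ ⊆ closedBall (0 : Ed d) 1) (x : Ed d) {l : ℝ}
    (hl : 0 < l) (a : Ed d) (ha : a ∉ closedBall x l) : scTF φ x l a = 0 := by
  have : φ (l⁻¹ • (a - x)) = 0 := by
    by_contra hcon
    apply ha
    have h1 := hφ (subset_tsupport φ hcon)
    rw [mem_closedBall, dist_eq_norm] at h1 ⊢
    rw [sub_zero, norm_smul, Real.norm_eq_abs, abs_of_pos (inv_pos.2 hl)] at h1
    rwa [inv_mul_le_iff₀ hl, mul_one] at h1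
  simp [scTF, this]

lemma bound_A {β ρ : ℝ} {m r : ℕ} {Kn : ℕ → Ed d → Ed d → ℝ} (hρ : 0 < ρ)
    (hK : RegKer d β m r ρ Kn)
    {K : Set (Ed d)} (hKc : IsCompact K) {lb : ℝ} (hlb : 1 ≤ lb) (g : ℝ) (N : ℕ) (hN : N ≤ m)
    (hNg : ∀ j : ℕ, j < N → (j:ℝ) ≤ g) :
    ∃ C : ℝ, 0 < C ∧ ∀ n, ∀ x ∈ K, ∀ l : ℝ, 0 < l → l ≤ lb → ∀ φ ∈ TBAnn d r g,
      ∀ k : MIdx d, mdeg k ≤ r → ∀ y ∈ closedBall x (lb + ρ),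
      |mderiv k (kstar (Kn n) (scTF φ x l)) y| ≤
        C * l ^ N * 2 ^ ((((d : ℝ) - β + (mdeg k : ℝ) + (N : ℝ))) * n) := by
  obtain ⟨c, hc, hc1, hc2⟩ := hK.2.2 (cthickening (lb + ρ) K) hKc.cthickening
  set V := volume.real (closedBall (0 : Ed d) 1) with hV
  have hV0 : 0 ≤ V := measureReal_nonneg
  refine ⟨(d:ℝ) ^ N * c * V + 1, by positivity, ?_⟩
  intro n x hx l hl hllb φ hφ k hk y hy
  have hyK : y ∈ cthickening (lb + ρ) K := closedBall_subset_cthickening hx _ hy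
  set ψ := scTF φ x l with hψd
  have hψ : IsTest ψ := isTest_scTF hφ.1.1 x hl
  rw [(kstar_deriv hK n hψ).2 k hk y]
  set G : Ed d → ℝ := fun x => mderiv k (Kn n x) y with hG
  have hGm : IsCr m G := (hK.1 n).isCr_left k hk y
  have hGc : Continuous G := hGm.continuous
  set P : Ed d → ℝ := fun a => ∑ j ∈ Finset.range N, 1 / (j.factorial : ℝ) * Dj j G x (a - x) with hP
  have hPc : Continuous P := by
    refine continuous_finset_sum _ fun j _ => ?_
    exact continuous_const.mul (continuous_Dj j G x)
  have hψc := hψ.1.continuous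
  set Q := (2:ℝ) ^ ((((d : ℝ) - β + (mdeg k : ℝ) + (N : ℝ))) * n) with hQ
  have hQ0 : 0 < Q := by positivity
  have hzero : (∫ a, ψ a * P a) = 0 := by
    rw [hP, integral_poly hψc hψ.2]
    refine Finset.sum_eq_zero fun j hj => ?_
    rw [Finset.mem_range] at hj
    rw [Finset.sum_eq_zero, mul_zero]
    intro s _
    rw [moment_scTF x hl, mul_zero]
    exact hφ.2.2.2 _ (by rw [mdeg_cnt]; exact hNg j hj)
  have hsplit : (∫ a, ψ a * G a) = ∫ a, ψ a * (G a - P a) := by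
    have : (∫ a, ψ a * (G a - P a)) = (∫ a, ψ a * G a) - ∫ a, ψ a * P a := by
      rw [← integral_sub]
      · congr 1; funext x; ring
      · exact Continuous.integrable_of_hasCompactSupport (by fun_prop) hψ.2.mul_right
      · exact Continuous.integrable_of_hasCompactSupport (by fun_prop) hψ.2.mul_right
    rw [this, hzero, sub_zero]
  have hb : ∀ a ∈ closedBall x l, |ψ a * (G a - P a)| ≤
      (l ^ d)⁻¹ * ((d:ℝ) ^ N * (l ^ N * (c * Q))) := by
    intro a ha
    rw [abs_mul]
    have haR : ‖a - x‖ ≤ l := by rwa [mem_closedBall, dist_eq_norm] at ha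
    have t0 : |ψ a| ≤ (l ^ d)⁻¹ := by
      simp only [hψd, scTF]
      rw [abs_mul, abs_of_nonneg (by positivity)]
      have := hφ.1.2.2 0 (by simp [mdeg_zero]) (l⁻¹ • (a - x))
      rw [mderiv_zero] at this
      exact mul_le_of_le_one_right (by positivity) this
    have t1 := taylor (hGm.mono hN) x (a - x) (c * Q) (fun t ht l' hl' => by
      have hmem : x + t • (a - x) ∈ cthickening (lb + ρ) K := by
        refine closedBall_subset_cthickening hx _ ?_
        rw [mem_closedBall, dist_eq_norm, add_sub_cancel_left, norm_smul, Real.norm_eq_abs,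
          abs_of_nonneg ht.1]
        have := norm_nonneg (a - x)
        nlinarith [ht.1, ht.2]
      have := hc1 n l' k (by rw [hl']; exact hN) hk _ hmem y hyK
      rw [hl'] at this
      exact this)
    rw [add_sub_cancel] at t1
    refine mul_le_mul t0 (t1.trans ?_) (abs_nonneg _) (by positivity)
    gcongr
  have h5 := abs_integral_ball_le (h := fun a => ψ a * (G a - P a)) hl.le
    (fun a ha => by simp only [hψd]; rw [scTF_zero_off hφ.1.2.1 x hl a ha, zero_mul]) hb
  rw [hsplit]
  refine h5.trans ?_
  have e1 : (l ^ d)⁻¹ * ((d:ℝ) ^ N * (l ^ N * (c * Q))) * (l ^ d * V) =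
      ((d:ℝ) ^ N * c * V) * l ^ N * Q := by
    field_simp
  rw [e1]
  gcongr
  linarith

lemma kstar_zero_off {β ρ : ℝ} {m r : ℕ} {Kn : ℕ → Ed d → Ed d → ℝ} (hK : RegKer d β m r ρ Kn)
    (n : ℕ) {ψ : Ed d → ℝ} {x : Ed d} {R : ℝ} (h0 : ∀ a, a ∉ closedBall x R → ψ a = 0) :
    ∀ y, y ∉ closedBall x (R + ρ * 2 ^ (-(n : ℝ))) → kstar (Kn n) ψ y = 0 := by
  intro y hy
  have : ∀ a, ψ a * Kn n a y = 0 := by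
    intro a
    by_cases ha : a ∈ closedBall x R
    · have : Kn n a y = 0 := by
        by_contra hcon
        apply hy
        have h1 := hK.2.1 n a y hcon
        rw [mem_closedBall] at ha ⊢
        have := dist_triangle y a x
        rw [dist_comm y a] at this
        linarith
      rw [this, mul_zero]
    · rw [h0 a ha, zero_mul]
  simp [kstar, this]

lemma mderiv_zero_off {g : Ed d → ℝ} {x : Ed d} {R : ℝ} (h0 : ∀ a, a ∉ closedBall x R → g a = 0)
    (k : MIdx d) : ∀ a, a ∉ closedBall x R → mderiv k g a = 0 := by
  intro a ha
  exact mderiv_zero_on (U := (closedBall x R)ᶜ) isClosed_closedBall.isOpen_compl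
    (fun z hz => h0 z hz) k a ha

lemma two_pow_le_one (n : ℕ) : (2:ℝ) ^ (-(n : ℝ)) ≤ 1 :=
  Real.rpow_le_one_of_one_le_of_nonpos (by norm_num) (by simp)

lemma ext_scale {f : DFunc d} {r : ℕ} {ρ α γ : ℝ} (hf : OrderExt f r) (hρ : 0 < ρ) (hαγ : α ≤ γ)
    {s R A C D : ℝ} (hs : 0 < s) (hR1 : min 1 ρ * s ≤ R) (hR2 : R ≤ (1 + ρ) * s)
    (hA : 0 < A) (hC : 0 ≤ C) (hD : 0 ≤ D) {g : Ed d → ℝ} {x : Ed d} (hg : IsCr r g)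
    (h0 : ∀ y, y ∉ closedBall x R → g y = 0)
    (hb : ∀ k, mdeg k ≤ r → ∀ y, |mderiv k g y| ≤ A * ((s ^ d)⁻¹ * (s⁻¹) ^ mdeg k))
    (ht : ∀ φ ∈ TB d r, |f (scTF φ x (2 * R))| ≤ C * (2 * R) ^ α * (D + 2 * R) ^ (γ - α)) :
    |f g| ≤ ((2 * (1 + ρ)) ^ (d + r) * (((2 * min 1 ρ) ^ α + (2 * (1 + ρ)) ^ α) *
      (2 * (1 + ρ)) ^ (γ - α))) * A * C * (s ^ α * (D + s) ^ (γ - α)) := by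
  have hc0 : 0 < min 1 ρ := lt_min one_pos hρ
  have hR : 0 < R := lt_of_lt_of_le (by positivity) hR1
  set b := 2 * (1 + ρ) with hbdef
  have hb1 : 1 ≤ b := by rw [hbdef]; linarith
  have hb0 : 0 < b := by linarith
  set l := 2 * R with hl
  have hl0 : 0 < l := by positivity
  have hlb : l ≤ b * s := by rw [hl, hbdef]; linarith
  have hla : 2 * min 1 ρ * s ≤ l := by rw [hl]; linarith
  have h1 : |f g| ≤ (A * b ^ (d + r)) * (C * l ^ α * (D + l) ^ (γ - α)) := by
    refine ext_bound hf hR hl (by positivity) hg h0 (fun k hk y => (hb k hk y).trans ?_) ht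
    rw [mul_assoc]
    refine mul_le_mul_of_nonneg_left ?_ hA.le
    have e : ∀ t : ℝ, (t ^ d)⁻¹ * (t⁻¹) ^ mdeg k = (t⁻¹) ^ (d + mdeg k) := by
      intro t; rw [pow_add, inv_pow t d]
    rw [e, e]
    have h2 : s⁻¹ ≤ b * l⁻¹ := by
      rw [← div_eq_mul_inv, inv_eq_one_div, div_le_div_iff₀ hs hl0]
      linarith
    calc (s⁻¹) ^ (d + mdeg k) ≤ (b * l⁻¹) ^ (d + mdeg k) := by gcongr
      _ = b ^ (d + mdeg k) * (l⁻¹) ^ (d + mdeg k) := mul_pow _ _ _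
      _ ≤ b ^ (d + r) * (l⁻¹) ^ (d + mdeg k) := by gcongr
  have h2 : l ^ α ≤ ((2 * min 1 ρ) ^ α + b ^ α) * s ^ α := by
    have p1 : 0 ≤ (2 * min 1 ρ) ^ α * s ^ α := by positivity
    have p2 : 0 ≤ b ^ α * s ^ α := by positivity
    rcases le_total 0 α with h | h
    · have : l ^ α ≤ (b * s) ^ α := Real.rpow_le_rpow hl0.le hlb h
      rw [Real.mul_rpow hb0.le hs.le] at this
      linarith
    · have : l ^ α ≤ (2 * min 1 ρ * s) ^ α := Real.rpow_le_rpow_of_nonpos (by positivity) hla h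
      rw [Real.mul_rpow (by positivity) hs.le] at this
      linarith
  have h3 : (D + l) ^ (γ - α) ≤ b ^ (γ - α) * (D + s) ^ (γ - α) := by
    rw [← Real.mul_rpow hb0.le (by positivity)]
    refine Real.rpow_le_rpow (by positivity) ?_ (by linarith)
    nlinarith
  refine h1.trans ?_
  calc (A * b ^ (d + r)) * (C * l ^ α * (D + l) ^ (γ - α))
      ≤ (A * b ^ (d + r)) * (C * (((2 * min 1 ρ) ^ α + b ^ α) * s ^ α) *
        (b ^ (γ - α) * (D + s) ^ (γ - α))) := by gcongr
    _ = _ := by ring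

lemma sum_bound {κ : ℝ} (hκ : 0 < κ) : ∃ S : ℝ, 0 ≤ S ∧ ∀ L : ℝ,
    Summable (fun n : ℕ => (2:ℝ) ^ (-(κ * |(n:ℝ) + L|))) ∧
    ∑' n : ℕ, (2:ℝ) ^ (-(κ * |(n:ℝ) + L|)) ≤ S := by
  have hq : (2:ℝ) ^ (-κ) < 1 := Real.rpow_lt_one_of_one_lt_of_neg (by norm_num) (by linarith)
  have hq0 : 0 ≤ (2:ℝ) ^ (-κ) := by positivity
  have hg : Summable (fun n : ℕ => ((2:ℝ) ^ (-κ)) ^ n) := summable_geometric_of_lt_one hq0 hq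
  have hz : Summable (fun j : ℤ => (2:ℝ) ^ (-(κ * |(j:ℝ)|))) := by
    have e : ∀ n : ℕ, (2:ℝ) ^ (-(κ * (n:ℝ))) = ((2:ℝ) ^ (-κ)) ^ n := by
      intro n
      rw [← Real.rpow_natCast, ← Real.rpow_mul (by norm_num)]
      congr 1; ring
    refine Summable.of_nat_of_neg ?_ ?_
    · simpa [e] using hg
    · simpa [e] using hg
  refine ⟨2 ^ κ * ∑' j : ℤ, (2:ℝ) ^ (-(κ * |(j:ℝ)|)),
    mul_nonneg (by positivity) (tsum_nonneg fun j => by positivity), fun L => ?_⟩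
  have hinj : Function.Injective (fun n : ℕ => (n:ℤ) + ⌊L⌋) := by
    intro a b h
    simpa using h
  have hs := (hz.comp_injective hinj).mul_left (2 ^ κ)
  have hle : ∀ n : ℕ, (2:ℝ) ^ (-(κ * |(n:ℝ) + L|)) ≤
      2 ^ κ * ((fun j : ℤ => (2:ℝ) ^ (-(κ * |(j:ℝ)|))) ∘ (fun n : ℕ => (n:ℤ) + ⌊L⌋)) n := by
    intro n
    simp only [Function.comp]
    rw [← Real.rpow_add (by norm_num)]
    refine Real.rpow_le_rpow_of_exponent_le (by norm_num) ?_
    push_cast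
    have h1 := Int.floor_le L
    have h2 := Int.lt_floor_add_one L
    have : |(n:ℝ) + ⌊L⌋| ≤ |(n:ℝ) + L| + 1 := by
      have h3 := abs_sub_abs_le_abs_sub ((n:ℝ) + ⌊L⌋) ((n:ℝ) + L)
      have h4 : |(n:ℝ) + ⌊L⌋ - ((n:ℝ) + L)| ≤ 1 := by
        rw [abs_le]; constructor <;> linarith
      linarith
    nlinarith
  have hsum := Summable.of_nonneg_of_le (fun n => by positivity) hle hs
  refine ⟨hsum, (hsum.tsum_le_tsum hle hs).trans ?_⟩
  rw [tsum_mul_left]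
  refine mul_le_mul_of_nonneg_left ?_ (by positivity)
  exact tsum_comp_le_tsum_of_inj hz (fun j => by positivity) hinj

lemma scTF_deriv_le {r : ℕ} {lb : ℝ} (hlb : 1 ≤ lb) {φ : Ed d → ℝ} (hφ : φ ∈ TB d r) (x : Ed d)
    {l : ℝ} (hl : 0 < l) (hl' : l ≤ lb) {j k : MIdx d} (hk : mdeg k ≤ r) (hj : mdeg j ≤ mdeg k)
    (y : Ed d) : |mderiv j (scTF φ x l) y| ≤ lb ^ r * ((l ^ d)⁻¹ * (l⁻¹) ^ mdeg k) := by
  rw [mderiv_scTF, abs_mul, abs_of_nonneg (by positivity)]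
  have h1 := hφ.2.2 j (hj.trans hk) (l⁻¹ • (y - x))
  refine (mul_le_of_le_one_right (by positivity) h1).trans ?_
  have h2 : (l⁻¹) ^ mdeg j ≤ lb ^ r * (l⁻¹) ^ mdeg k := by
    obtain ⟨e, he⟩ := Nat.exists_eq_add_of_le hj
    have : (l⁻¹) ^ mdeg j = l ^ e * (l⁻¹) ^ mdeg k := by
      rw [he, pow_add, inv_pow l e]
      field_simp
    rw [this]
    gcongr
    calc l ^ e ≤ lb ^ e := by gcongr
      _ ≤ lb ^ r := pow_le_pow_right₀ hlb (by omega)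
  calc (l ^ d)⁻¹ * (l⁻¹) ^ mdeg j ≤ (l ^ d)⁻¹ * (lb ^ r * (l⁻¹) ^ mdeg k) := by gcongr
    _ = _ := by ring

/-- Kernel terms at scale below `l`. -/
lemma term_B {β ρ α γ lb : ℝ} {m r : ℕ} {Kn : ℕ → Ed d → Ed d → ℝ} (hρ : 0 < ρ) (hαγ : α ≤ γ)
    (hK : RegKer d β m r ρ Kn) {K : Set (Ed d)} (hKc : IsCompact K) (hlb : 1 ≤ lb) :
    ∃ Q : ℝ, 0 < Q ∧ ∀ F : GermF d, (∀ x y : Ed d, OrderExt (fun φ => F y φ - F x φ) r) →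
      ∀ C, 0 ≤ C → CohB F α γ r K (2 * (lb + ρ)) C → ∀ n : ℕ, ∀ x ∈ K, ∀ y ∈ K, ∀ l, 0 < l →
        l ≤ lb → (2:ℝ) ^ (-(n:ℝ)) ≤ l → ∀ φ ∈ TB d r,
        |F y (kstar (Kn n) (scTF φ x l)) - F x (kstar (Kn n) (scTF φ x l))| ≤
          Q * C * (2 ^ (-(β * (n:ℝ))) * (l ^ α * (dist y x + l) ^ (γ - α))) := by
  obtain ⟨CB, hCB, hB⟩ := bound_B hρ hK (K1 := cthickening (lb + ρ) K) hKc.cthickening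
  have hc0 : 0 < min 1 ρ := lt_min one_pos hρ
  refine ⟨((2 * (1 + ρ)) ^ (d + r) * (((2 * min 1 ρ) ^ α + (2 * (1 + ρ)) ^ α) *
      (2 * (1 + ρ)) ^ (γ - α))) * (CB * lb ^ r), by positivity, ?_⟩
  intro F hF C hC hcoh n x hx y hy l hl hllb hnl φ hφ
  have hn1 := two_pow_le_one n
  have hn0 : (0:ℝ) < 2 ^ (-(n:ℝ)) := by positivity
  have hρn : ρ * (2:ℝ) ^ (-(n:ℝ)) ≤ ρ := mul_le_of_le_one_right hρ.le hn1
  have hρl : ρ * (2:ℝ) ^ (-(n:ℝ)) ≤ ρ * l := by gcongr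
  have htest := isTest_scTF hφ.1 x hl
  have h0 := kstar_zero_off hK n (scTF_zero_off hφ.2.1 x hl)
  have hmin : min 1 ρ * l ≤ l := mul_le_of_le_one_left hl.le (min_le_left _ _)
  have := ext_scale (hF x y) hρ hαγ (s := l) (R := l + ρ * 2 ^ (-(n:ℝ)))
    (A := CB * lb ^ r * 2 ^ (-(β * (n:ℝ)))) (C := C) (D := dist y x) hl
    (by nlinarith) (by linarith) (by positivity) hC dist_nonneg
    (kstar_deriv hK n htest).1 h0 ?_ ?_
  · refine this.trans (le_of_eq ?_)
    ring
  · intro k hk z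
    by_cases hz : z ∈ closedBall x (l + ρ * 2 ^ (-(n:ℝ)))
    · have hz' : z ∈ cthickening (lb + ρ) K := by
        refine mem_cthickening_of_dist_le z x _ K hx ?_
        rw [mem_closedBall] at hz
        linarith
      refine (hB n _ htest _ k hk (fun j hj w => scTF_deriv_le hlb hφ x hl hllb hk hj w) z hz').trans
        (le_of_eq ?_)
      ring
    · rw [mderiv_zero_off h0 k z hz, abs_zero]
      positivity
  · intro ψ hψ
    exact hcoh x hx y hy _ (by positivity) (by linarith) ψ hψ

/-- Kernel terms at scale above `l`. -/
lemma term_A {β ρ α γ lb : ℝ} {m r : ℕ} {Kn : ℕ → Ed d → Ed d → ℝ} (hρ : 0 < ρ) (hαγ : α ≤ γ)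
    (hK : RegKer d β m r ρ Kn) {K : Set (Ed d)} (hKc : IsCompact K) (hlb : 1 ≤ lb)
    (N : ℕ) (hN : N ≤ m) (hNg : ∀ j : ℕ, j < N → (j:ℝ) ≤ γ + β) :
    ∃ Q : ℝ, 0 < Q ∧ ∀ F : GermF d, (∀ x y : Ed d, OrderExt (fun φ => F y φ - F x φ) r) →
      ∀ C, 0 ≤ C → CohB F α γ r K (2 * (lb + ρ)) C → ∀ n : ℕ, ∀ x ∈ K, ∀ y ∈ K, ∀ l, 0 < l →
        l ≤ lb → l ≤ (2:ℝ) ^ (-(n:ℝ)) → ∀ φ ∈ TBAnn d r (γ + β),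
        |F y (kstar (Kn n) (scTF φ x l)) - F x (kstar (Kn n) (scTF φ x l))| ≤
          Q * C * (l ^ N * 2 ^ (((N:ℝ) - β) * n) * (((2:ℝ) ^ (-(n:ℝ))) ^ α *
            (dist y x + (2:ℝ) ^ (-(n:ℝ))) ^ (γ - α))) := by
  obtain ⟨CA, hCA, hA⟩ := bound_A hρ hK hKc hlb (γ + β) N hN hNg
  have hc0 : 0 < min 1 ρ := lt_min one_pos hρ
  refine ⟨((2 * (1 + ρ)) ^ (d + r) * (((2 * min 1 ρ) ^ α + (2 * (1 + ρ)) ^ α) *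
      (2 * (1 + ρ)) ^ (γ - α))) * CA, by positivity, ?_⟩
  intro F hF C hC hcoh n x hx y hy l hl hllb hnl φ hφ
  have hn1 := two_pow_le_one n
  have hn0 : (0:ℝ) < 2 ^ (-(n:ℝ)) := by positivity
  have hρn : ρ * (2:ℝ) ^ (-(n:ℝ)) ≤ ρ := mul_le_of_le_one_right hρ.le hn1
  have htest := isTest_scTF hφ.1.1 x hl
  have h0 := kstar_zero_off hK n (scTF_zero_off hφ.1.2.1 x hl)
  have hmin : min 1 ρ * (2:ℝ) ^ (-(n:ℝ)) ≤ ρ * (2:ℝ) ^ (-(n:ℝ)) := by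
    gcongr; exact min_le_right _ _
  have := ext_scale (hF x y) hρ hαγ (s := (2:ℝ) ^ (-(n:ℝ))) (R := l + ρ * 2 ^ (-(n:ℝ)))
    (A := CA * l ^ N * 2 ^ (((N:ℝ) - β) * n)) (C := C) (D := dist y x) hn0
    (by linarith) (by linarith) (by positivity) hC dist_nonneg
    (kstar_deriv hK n htest).1 h0 ?_ ?_
  · refine this.trans (le_of_eq ?_)
    ring
  · intro k hk z
    by_cases hz : z ∈ closedBall x (l + ρ * 2 ^ (-(n:ℝ)))
    · have hz' : z ∈ closedBall x (lb + ρ) := closedBall_subset_closedBall (by linarith) hz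
      refine (hA n x hx l hl hllb φ hφ k hk z hz').trans (le_of_eq ?_)
      have e1 : (((2:ℝ) ^ (-(n:ℝ))) ^ d)⁻¹ * (((2:ℝ) ^ (-(n:ℝ)))⁻¹) ^ mdeg k =
          2 ^ (((d:ℝ) + mdeg k) * n) := by
        rw [← inv_pow, ← pow_add, Real.rpow_neg (by norm_num), inv_inv, ← Real.rpow_natCast,
          ← Real.rpow_mul (by norm_num)]
        push_cast
        congr 1; ring
      rw [e1, mul_assoc (CA * l ^ N), ← Real.rpow_add (by norm_num)]
      congr 2; ring
    · rw [mderiv_zero_off h0 k z hz, abs_zero]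
      positivity
  · intro ψ hψ
    exact hcoh x hx y hy _ (by positivity) (by linarith) ψ hψ

lemma arith_B {α β κ l X : ℝ} (hl : 0 < l) (hX : 0 ≤ X) (n : ℕ) (hκ : κ ≤ β)
    (h : (2:ℝ) ^ (-(n:ℝ)) ≤ l) :
    2 ^ (-(β * (n:ℝ))) * (l ^ α * X) ≤
      l ^ (α + β) * X * 2 ^ (-(κ * |(n:ℝ) + Real.logb 2 l|)) := by
  set L := Real.logb 2 l with hL
  have e : l = 2 ^ L := (Real.rpow_logb (by norm_num) (by norm_num) hl).symm
  have hnL : 0 ≤ (n:ℝ) + L := by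
    rw [e] at h
    have := (Real.rpow_le_rpow_left_iff (by norm_num : (1:ℝ) < 2)).1 h
    linarith
  rw [abs_of_nonneg hnL, e, ← Real.rpow_mul (by norm_num), ← Real.rpow_mul (by norm_num)]
  have : (2:ℝ) ^ (-(β * (n:ℝ))) * 2 ^ (L * α) ≤ 2 ^ (L * (α + β)) * 2 ^ (-(κ * ((n:ℝ) + L))) := by
    rw [← Real.rpow_add (by norm_num), ← Real.rpow_add (by norm_num)]
    refine Real.rpow_le_rpow_of_exponent_le (by norm_num) ?_
    nlinarith
  calc _ = (2:ℝ) ^ (-(β * (n:ℝ))) * 2 ^ (L * α) * X := by ring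
    _ ≤ 2 ^ (L * (α + β)) * 2 ^ (-(κ * ((n:ℝ) + L))) * X := by gcongr
    _ = _ := by ring

lemma arith_A {α β γ κ l D : ℝ} (hl : 0 < l) (hD : 0 ≤ D) (hαγ : α ≤ γ) (n N : ℕ)
    (hκ : κ ≤ N - β - γ) (h : l ≤ (2:ℝ) ^ (-(n:ℝ))) :
    l ^ N * 2 ^ (((N:ℝ) - β) * n) * (((2:ℝ) ^ (-(n:ℝ))) ^ α * (D + (2:ℝ) ^ (-(n:ℝ))) ^ (γ - α)) ≤
      l ^ (α + β) * (D + l) ^ (γ - α) * 2 ^ (-(κ * |(n:ℝ) + Real.logb 2 l|)) := by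
  set L := Real.logb 2 l with hL
  have e : l = 2 ^ L := (Real.rpow_logb (by norm_num) (by norm_num) hl).symm
  have hnL : (n:ℝ) + L ≤ 0 := by
    rw [e] at h
    have := (Real.rpow_le_rpow_left_iff (by norm_num : (1:ℝ) < 2)).1 h
    linarith
  have h1 : D + (2:ℝ) ^ (-(n:ℝ)) ≤ 2 ^ (-((n:ℝ) + L)) * (D + l) := by
    have e2 : (2:ℝ) ^ (-((n:ℝ) + L)) * l = 2 ^ (-(n:ℝ)) := by
      rw [e, ← Real.rpow_add (by norm_num)]
      congr 1; ring
    have : 1 ≤ (2:ℝ) ^ (-((n:ℝ) + L)) := Real.one_le_rpow (by norm_num) (by linarith)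
    nlinarith
  have h2 : (D + (2:ℝ) ^ (-(n:ℝ))) ^ (γ - α) ≤ 2 ^ (-((n:ℝ) + L) * (γ - α)) * (D + l) ^ (γ - α) := by
    rw [Real.rpow_mul (by norm_num), ← Real.mul_rpow (by positivity) (by positivity)]
    exact Real.rpow_le_rpow (by positivity) h1 (by linarith)
  have h3 : l ^ N * 2 ^ (((N:ℝ) - β) * n) * (((2:ℝ) ^ (-(n:ℝ))) ^ α * 2 ^ (-((n:ℝ) + L) * (γ - α)))
      ≤ l ^ (α + β) * 2 ^ (-(κ * |(n:ℝ) + L|)) := by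
    rw [abs_of_nonpos hnL, ← Real.rpow_natCast l, e, ← Real.rpow_mul (by norm_num),
      ← Real.rpow_mul (by norm_num), ← Real.rpow_mul (by norm_num)]
    simp only [← Real.rpow_add (show (0:ℝ) < 2 by norm_num)]
    refine Real.rpow_le_rpow_of_exponent_le (by norm_num) ?_
    nlinarith
  calc _ ≤ l ^ N * 2 ^ (((N:ℝ) - β) * n) * (((2:ℝ) ^ (-(n:ℝ))) ^ α *
        (2 ^ (-((n:ℝ) + L) * (γ - α)) * (D + l) ^ (γ - α))) := by gcongr
    _ = (l ^ N * 2 ^ (((N:ℝ) - β) * n) * (((2:ℝ) ^ (-(n:ℝ))) ^ α * 2 ^ (-((n:ℝ) + L) * (γ - α)))) *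
        (D + l) ^ (γ - α) := by ring
    _ ≤ (l ^ (α + β) * 2 ^ (-(κ * |(n:ℝ) + L|))) * (D + l) ^ (γ - α) := by gcongr
    _ = _ := by ring

lemma test_bounded {ψ : Ed d → ℝ} (hψ : IsTest ψ) (r : ℕ) :
    ∃ M : ℝ, ∀ k, mdeg k ≤ r → ∀ x, |mderiv k ψ x| ≤ M := by
  have hcr := isCr_of_contDiff hψ.1 r
  obtain ⟨R, hR⟩ := hψ.2.isCompact.isBounded.subset_closedBall (0 : Ed d)
  have h0 : ∀ a, a ∉ closedBall (0 : Ed d) R → ψ a = 0 := fun a ha =>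
    image_eq_zero_of_notMem_tsupport fun h => ha (hR h)
  have h1 : ∀ k : MIdx d, ∃ M : ℝ, mdeg k ≤ r → ∀ x, |mderiv k ψ x| ≤ M := by
    intro k
    by_cases hk : mdeg k ≤ r
    · obtain ⟨M, hM⟩ := (hasCompactSupport_of_ball (mderiv_zero_off h0 k)).exists_bound_of_continuous
        (hcr k hk).1
      exact ⟨M, fun _ x => hM x⟩
    · exact ⟨0, fun h => absurd h hk⟩
  choose M hM using h1
  refine ⟨∑ k ∈ (finite_mdeg (d := d) r).toFinset, |M k|, fun k hk x => ?_⟩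
  refine (hM k hk x).trans ((le_abs_self _).trans ?_)
  exact Finset.single_le_sum (f := fun k => |M k|) (fun _ _ => abs_nonneg _) (by simpa using hk)

lemma summable_terms {β ρ : ℝ} {m r : ℕ} {Kn : ℕ → Ed d → Ed d → ℝ} (hβ : 0 < β) (hρ : 0 < ρ)
    (hK : RegKer d β m r ρ Kn) {f : DFunc d} (hf : OrderExt f r) {ψ : Ed d → ℝ} (hψ : IsTest ψ) :
    Summable (fun n => f (kstar (Kn n) ψ)) := by
  obtain ⟨R, hR⟩ := hψ.2.isCompact.isBounded.subset_closedBall (0 : Ed d)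
  have h0 : ∀ a, a ∉ closedBall (0 : Ed d) R → ψ a = 0 := fun a ha =>
    image_eq_zero_of_notMem_tsupport fun h => ha (hR h)
  obtain ⟨M, hM⟩ := test_bounded hψ r
  have hM0 : 0 ≤ M := (abs_nonneg _).trans (hM 0 (by simp [mdeg_zero]) 0)
  obtain ⟨CB, hCB, hB⟩ := bound_B hρ hK (K1 := closedBall (0 : Ed d) (R + ρ)) (isCompact_closedBall _ _)
  obtain ⟨C', hC'⟩ := hf.2.2 (closedBall (0 : Ed d) (R + ρ)) (isCompact_closedBall _ _)
  have hk0 : ∀ n, ∀ y, y ∉ closedBall (0 : Ed d) (R + ρ) → kstar (Kn n) ψ y = 0 := by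
    intro n y hy
    refine kstar_zero_off hK n h0 y fun h => hy ?_
    refine closedBall_subset_closedBall ?_ h
    have := mul_le_of_le_one_right hρ.le (two_pow_le_one n)
    linarith
  have hbd : ∀ n : ℕ, ‖f (kstar (Kn n) ψ)‖ ≤ |C'| * (CB * M) * ((2:ℝ) ^ (-β)) ^ n := by
    intro n
    have e : (2:ℝ) ^ (-(β * (n:ℝ))) = ((2:ℝ) ^ (-β)) ^ n := by
      rw [← Real.rpow_natCast, ← Real.rpow_mul (by norm_num)]
      congr 1; ring
    have h1 := hC' _ (kstar_deriv hK n hψ).1 (hasCompactSupport_of_ball (hk0 n))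
      (tsupport_of_ball (hk0 n))
    have h2 : crNorm r (kstar (Kn n) ψ) ≤ CB * M * ((2:ℝ) ^ (-β)) ^ n := by
      refine crNorm_le (by positivity) fun k hk y => ?_
      by_cases hy : y ∈ closedBall (0 : Ed d) (R + ρ)
      · rw [← e]
        exact hB n ψ hψ M k hk (fun l hl x => hM l (hl.trans hk) x) y hy
      · rw [mderiv_zero_off (hk0 n) k y hy, abs_zero]
        positivity
    have h3 : 0 ≤ crNorm r (kstar (Kn n) ψ) :=
      Real.iSup_nonneg fun k => Real.iSup_nonneg fun x => abs_nonneg _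
    calc ‖f (kstar (Kn n) ψ)‖ ≤ C' * crNorm r (kstar (Kn n) ψ) := h1
      _ ≤ |C'| * crNorm r (kstar (Kn n) ψ) := by gcongr; exact le_abs_self _
      _ ≤ |C'| * (CB * M * ((2:ℝ) ^ (-β)) ^ n) := by gcongr
      _ = _ := by ring
  refine Summable.of_norm_bounded ((summable_geometric_of_lt_one (by positivity) ?_).mul_left _) hbd
  exact Real.rpow_lt_one_of_one_lt_of_neg (by norm_num) (by linarith)

/-- Theorem 4.3, integration of germs — coherence: if `𝖪` is a
`β`-regularising kernel of order `(m,r)` with range `ρ`, `α ≤ γ` and `m > γ + β`, then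
for every compact `K` and `λ̄ ∈ [1,∞)` there is a constant `cst'` such that for every
`(α,γ)`-coherent germ `F` of order `r`, the differences `𝖪F_y - 𝖪F_x = 𝖪(F_y - F_x)`
are well-defined and the germ `𝖪F` is weakly `(α+β, γ+β)`-coherent of order `r`, with
`‖𝖪F‖_{weak-coh;K,λ̄,r} ≤ cst' ‖F‖_{coh;K,2(λ̄+ρ),r}`. -/
theorem integration_of_germs_coherence
    (d : ℕ) (β ρ α γ : ℝ) (m r : ℕ) (hβ : 0 < β) (hρ : 0 < ρ)
    (hαγ : α ≤ γ) (hm : γ + β < (m : ℝ))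
    (Kn : ℕ → Ed d → Ed d → ℝ) (hK : RegKer d β m r ρ Kn) :
    ∀ K : Set (Ed d), IsCompact K → ∀ lb : ℝ, 1 ≤ lb → ∃ cst : ℝ,
      ∀ F : GermF d, IsGerm F →
        (∀ x y : Ed d, OrderExt (fun φ => F y φ - F x φ) r) → Coh F α γ r →
        ∃ KD : Ed d → Ed d → DFunc d,
          (∀ x y : Ed d, ∀ ψ : Ed d → ℝ, IsTest ψ →
            HasSum (fun n => F y (kstar (Kn n) ψ) - F x (kstar (Kn n) ψ)) (KD x y ψ)) ∧
          ∀ C : ℝ, CohB F α γ r K (2 * (lb + ρ)) C →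
            WCohBD KD (α + β) (γ + β) r K lb (cst * C) := by
  intro K hKc lb hlb
  -- order of Taylor expansion
  have hex : ∃ N : ℕ, γ + β < (N : ℝ) := ⟨m, hm⟩
  set N := Nat.find hex with hNdef
  have hN1 : γ + β < (N : ℝ) := Nat.find_spec hex
  have hNm : N ≤ m := Nat.find_min' hex hm
  have hNg : ∀ j : ℕ, j < N → (j : ℝ) ≤ γ + β := fun j hj => not_lt.1 (Nat.find_min hex hj)
  obtain ⟨QB, hQB, hB⟩ := term_B (γ := γ) hρ hαγ hK hKc hlb
  obtain ⟨QA, hQA, hA⟩ := term_A hρ hαγ hK hKc hlb N hNm hNg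
  set κ := min β ((N : ℝ) - β - γ) with hκdef
  have hκ : 0 < κ := lt_min hβ (by linarith)
  obtain ⟨S, hS, hsum⟩ := sum_bound hκ
  set P := (Metric.diam K + 1) ^ (γ - α) with hP
  have hdiam : 0 ≤ Metric.diam K := Metric.diam_nonneg
  refine ⟨(QA + QB) * S * (1 + P), ?_⟩
  intro F hF hext _
  refine ⟨fun x y ψ => ∑' n, (F y (kstar (Kn n) ψ) - F x (kstar (Kn n) ψ)), ?_, ?_⟩
  · intro x y ψ hψ
    exact (summable_terms hβ hρ hK (hext x y) hψ).hasSum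
  intro C hcoh
  have hC0 : ∀ x ∈ K, 0 ≤ C := by
    intro x hx
    have h0 : (0 : Ed d → ℝ) ∈ TB d r := by
      refine ⟨⟨contDiff_const, HasCompactSupport.zero⟩, by simp, fun k _ z => ?_⟩
      rw [mderiv_zero_on (f := (0 : Ed d → ℝ)) (U := Set.univ) isOpen_univ (fun _ _ => rfl) k z trivial, abs_zero]
      exact zero_le_one
    have h1 := hcoh x hx x hx 1 one_pos (by linarith) 0 h0
    have h2 := (abs_nonneg _).trans h1
    simpa using h2
  have hPpos : 0 ≤ P := by positivity
  refine ⟨?_, ?_⟩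
  · intro x hx y hy l hl hllb φ hφ
    have hC := hC0 x hx
    set X := (dist y x + l) ^ (γ - α) with hX
    have hX0 : 0 ≤ X := by positivity
    have hterm : ∀ n : ℕ, ‖F y (kstar (Kn n) (scTF φ x l)) - F x (kstar (Kn n) (scTF φ x l))‖ ≤
        (QA + QB) * C * (l ^ (α + β) * X) * 2 ^ (-(κ * |(n:ℝ) + Real.logb 2 l|)) := by
      intro n
      rw [Real.norm_eq_abs]
      rcases le_total ((2:ℝ) ^ (-(n:ℝ))) l with h | h
      · refine (hB F hext C hC hcoh n x hx y hy l hl hllb h φ hφ.1).trans ?_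
        calc _ ≤ QB * C * (l ^ (α + β) * X * 2 ^ (-(κ * |(n:ℝ) + Real.logb 2 l|))) := by
              refine mul_le_mul_of_nonneg_left ?_ (by positivity)
              exact arith_B hl hX0 n (min_le_left _ _) h
          _ ≤ (QA + QB) * C * (l ^ (α + β) * X * 2 ^ (-(κ * |(n:ℝ) + Real.logb 2 l|))) := by
              gcongr; linarith
          _ = _ := by ring
      · refine (hA F hext C hC hcoh n x hx y hy l hl hllb h φ hφ).trans ?_
        calc _ ≤ QA * C * (l ^ (α + β) * X * 2 ^ (-(κ * |(n:ℝ) + Real.logb 2 l|))) := by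
              refine mul_le_mul_of_nonneg_left ?_ (by positivity)
              exact arith_A hl dist_nonneg hαγ n N (min_le_right _ _) h
          _ ≤ (QA + QB) * C * (l ^ (α + β) * X * 2 ^ (-(κ * |(n:ℝ) + Real.logb 2 l|))) := by
              gcongr; linarith
          _ = _ := by ring
    obtain ⟨hs1, hs2⟩ := hsum (Real.logb 2 l)
    have h1 := tsum_of_norm_bounded (hs1.hasSum.mul_left _) hterm
    rw [Real.norm_eq_abs] at h1
    have e : γ + β - (α + β) = γ - α := by ring
    rw [e]
    refine h1.trans ?_
    calc _ ≤ (QA + QB) * C * (l ^ (α + β) * X) * S := by gcongr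
      _ = (QA + QB) * S * 1 * C * l ^ (α + β) * X := by ring
      _ ≤ (QA + QB) * S * (1 + P) * C * l ^ (α + β) * X := by gcongr; linarith
  · intro x hx y hy φ hφ
    have hC := hC0 x hx
    have hdist : dist y x ≤ Metric.diam K := dist_le_diam_of_mem hKc.isBounded hy hx
    have hXP : (dist y x + 1) ^ (γ - α) ≤ P :=
      Real.rpow_le_rpow (by positivity) (by linarith) (by linarith)
    have hterm : ∀ n : ℕ, ‖F y (kstar (Kn n) (scTF φ x 1)) - F x (kstar (Kn n) (scTF φ x 1))‖ ≤
        (QB * C * P) * 2 ^ (-(κ * |(n:ℝ) + Real.logb 2 1|)) := by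
      intro n
      rw [Real.norm_eq_abs]
      have h := two_pow_le_one n
      refine (hB F hext C hC hcoh n x hx y hy 1 one_pos hlb h φ hφ).trans ?_
      have h2 := arith_B (α := α) one_pos (X := (dist y x + 1) ^ (γ - α)) (by positivity) n
        (min_le_left β ((N : ℝ) - β - γ)) h
      rw [Real.one_rpow (α + β), one_mul] at h2
      calc _ ≤ QB * C * ((dist y x + 1) ^ (γ - α) * 2 ^ (-(κ * |(n:ℝ) + Real.logb 2 1|))) := by
            gcongr
        _ ≤ QB * C * (P * 2 ^ (-(κ * |(n:ℝ) + Real.logb 2 1|))) := by gcongr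
        _ = _ := by ring
    obtain ⟨hs1, hs2⟩ := hsum (Real.logb 2 1)
    have h1 := tsum_of_norm_bounded (hs1.hasSum.mul_left _) hterm
    rw [Real.norm_eq_abs] at h1
    refine h1.trans ?_
    calc _ ≤ (QB * C * P) * S := by gcongr
      _ = QB * S * P * C := by ring
      _ ≤ (QA + QB) * S * (1 + P) * C := by gcongr <;> linarith
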